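/- Let G be a finite group that is minimally faithful of degree 3. Then the commutator subgroup [G,G] is abelian. -/

import Mathlib

/-- `rdim G` is the smallest `n` such that `G` has a faithful `n`-dimensional
complex representation, i.e. an injective group homomorphism `G →* GL n ℂ`. -/
noncomputable def rdim (G : Type*) [Group G] : ℕ :=
  sInf {n : ℕ | ∃ ρ : G →* GL (Fin n) ℂ, Function.Injective ρ}

/-- `G` is minimally faithful of degree `n` if `rdim G = n` and every proper
subgroup has strictly smaller representation dimension. -/
def MinFaithful (G : Type*) [Group G] (n : ℕ) : Prop :=
  rdim G = n ∧ ∀ H : Subgroup G, H ≠ ⊤ → rdim H < n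

/-- Two by two complex matrices. -/
abbrev M2 := Matrix (Fin 2) (Fin 2) ℂ

/-- `G` embeds in two by two matrices. -/
def E2 (G : Type*) [Group G] : Prop := ∃ σ : G →* M2, Function.Injective σ

theorem E2.sub {G : Type*} [Group G] (h : E2 G) (H : Subgroup G) : E2 H := by
  obtain ⟨σ, hσ⟩ := h
  exact ⟨σ.comp H.subtype, hσ.comp H.subtype_injective⟩

/-- scalar matrices -/
def IsSc (T : M2) : Prop := T 0 1 = 0 ∧ T 1 0 = 0 ∧ T 0 0 = T 1 1

theorem IsSc.commute {T : M2} (h : IsSc T) (A : M2) : T * A = A * T := by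
  obtain ⟨h1, h2, h3⟩ := h
  ext i j
  fin_cases i <;> fin_cases j <;> simp [Matrix.mul_apply, Fin.sum_univ_two, h1, h2, h3] <;> ring

theorem comm_eqs {T A : M2} (h : T * A = A * T) :
    T 0 1 * A 1 0 = A 0 1 * T 1 0 ∧
    T 0 1 * (A 1 1 - A 0 0) = A 0 1 * (T 1 1 - T 0 0) ∧
    T 1 0 * (A 1 1 - A 0 0) = A 1 0 * (T 1 1 - T 0 0) := by
  have h00 := congrFun (congrFun h 0) 0
  have h01 := congrFun (congrFun h 0) 1
  have h10 := congrFun (congrFun h 1) 0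
  simp only [Matrix.mul_apply, Fin.sum_univ_two] at h00 h01 h10
  refine ⟨?_, ?_, ?_⟩
  · linear_combination h00
  · linear_combination h01
  · linear_combination -h10

/-- Whatever commutes with a nonscalar `T` is an affine combination of `1` and `T`. -/
theorem comm_nonscalar {T A : M2} (hT : ¬ IsSc T) (h : T * A = A * T) :
    ∃ a b : ℂ, A = a • (1 : M2) + b • T := by
  obtain ⟨e1, e2, e3⟩ := comm_eqs h
  by_cases h1 : T 0 1 = 0
  · by_cases h2 : T 1 0 = 0
    · have h3 : T 0 0 - T 1 1 ≠ 0 := fun h3 => hT ⟨h1, h2, sub_eq_zero.1 h3⟩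
      have h3' : T 1 1 - T 0 0 ≠ 0 := fun h => h3 (by linear_combination -h)
      have a01 : A 0 1 = 0 := by
        rw [h1, zero_mul] at e2
        exact (mul_eq_zero.1 e2.symm).resolve_right h3'
      have a10 : A 1 0 = 0 := by
        rw [h2, zero_mul] at e3
        exact (mul_eq_zero.1 e3.symm).resolve_right h3'
      refine ⟨A 0 0 - (A 0 0 - A 1 1) / (T 0 0 - T 1 1) * T 0 0, (A 0 0 - A 1 1) / (T 0 0 - T 1 1), ?_⟩
      ext i j
      fin_cases i <;> fin_cases j <;> simp [h1, h2, a01, a10]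
      field_simp
      ring
    · refine ⟨A 0 0 - A 1 0 / T 1 0 * T 0 0, A 1 0 / T 1 0, ?_⟩
      ext i j
      fin_cases i <;> fin_cases j <;> simp
      · field_simp; linear_combination -e1
      · field_simp
      · field_simp; linear_combination e3
  · refine ⟨A 0 0 - A 0 1 / T 0 1 * T 0 0, A 0 1 / T 0 1, ?_⟩
    ext i j
    fin_cases i <;> fin_cases j <;> simp
    · field_simp
    · field_simp; linear_combination e1
    · field_simp; linear_combination e2

theorem comm_of_nonscalar {T A B : M2} (hT : ¬ IsSc T) (hA : T * A = A * T) (hB : T * B = B * T) :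
    A * B = B * A := by
  obtain ⟨a, b, rfl⟩ := comm_nonscalar hT hA
  obtain ⟨c, d, rfl⟩ := comm_nonscalar hT hB
  simp only [add_mul, mul_add, smul_mul_assoc, mul_smul_comm, one_mul, mul_one, smul_add, smul_smul]
  rw [mul_comm a c, mul_comm a d, mul_comm b c, mul_comm b d]
  abel

theorem IsSc.eq_smul {T : M2} (h : IsSc T) : T = T 0 0 • (1 : M2) := by
  obtain ⟨h1, h2, h3⟩ := h
  ext i j
  fin_cases i <;> fin_cases j <;> simp [h1, h2, h3]

theorem sq_one_scalar {T : M2} (h : IsSc T) (h2 : T * T = 1) : T = 1 ∨ T = -1 := by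
  have e := h.eq_smul
  have h00 := congrFun (congrFun h2 0) 0
  simp only [Matrix.mul_apply, Fin.sum_univ_two, h.1, h.2.1, Matrix.one_apply_eq] at h00
  have : T 0 0 = 1 ∨ T 0 0 = -1 := by
    apply mul_self_eq_one_iff.1; linear_combination h00
  rcases this with h | h
  · left; rw [e, h, one_smul]
  · right; rw [e, h, neg_smul, one_smul]

theorem det_one_scalar {T : M2} (h : IsSc T) (h2 : T.det = 1) : T * T = 1 := by
  have e := h.eq_smul
  rw [Matrix.det_fin_two, h.1, ← h.2.2] at h2
  rw [e]
  simp only [smul_mul_assoc, mul_smul_comm, one_mul, smul_smul]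
  rw [show T 0 0 * T 0 0 = 1 by linear_combination h2, one_smul]

theorem sl_invol {T : M2} (h : T * T = 1) (hd : T.det = 1) : T = 1 ∨ T = -1 := by
  refine sq_one_scalar ?_ h
  have h00 := congrFun (congrFun h 0) 0
  have h01 := congrFun (congrFun h 0) 1
  have h10 := congrFun (congrFun h 1) 0
  have h11 := congrFun (congrFun h 1) 1
  simp only [Matrix.mul_apply, Fin.sum_univ_two, Matrix.one_apply_eq] at h00 h01 h10 h11
  rw [Matrix.one_apply_ne (by decide)] at h01 h10
  rw [Matrix.det_fin_two] at hd
  have hs : T 0 0 + T 1 1 ≠ 0 := by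
    intro hs
    have : T 1 1 = - T 0 0 := by linear_combination hs
    rw [this] at hd
    have : (2:ℂ) = 0 := by linear_combination - hd - h00
    norm_num at this
  refine ⟨?_, ?_, ?_⟩
  · have : T 0 1 * (T 0 0 + T 1 1) = 0 := by linear_combination h01
    exact (mul_eq_zero.1 this).resolve_right hs
  · have : T 1 0 * (T 0 0 + T 1 1) = 0 := by linear_combination h10
    exact (mul_eq_zero.1 this).resolve_right hs
  · have : (T 0 0 - T 1 1) * (T 0 0 + T 1 1) = 0 := by linear_combination h00 - h11
    exact sub_eq_zero.1 ((mul_eq_zero.1 this).resolve_right hs)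

/-- commuting involutions -/
theorem invol_comm {T Y : M2} (hT : ¬ IsSc T) (h2 : T * T = 1) (hY : T * Y = Y * T)
    (hY2 : Y * Y = 1) : Y = 1 ∨ Y = -1 ∨ Y = T ∨ Y = -T := by
  obtain ⟨a, b, rfl⟩ := comm_nonscalar hT hY
  have e : (a * a + b * b) • (1 : M2) + (2 * a * b) • T = 1 := by
    refine Eq.trans ?_ hY2
    simp only [add_mul, mul_add, smul_mul_assoc, mul_smul_comm, one_mul, mul_one, smul_add,
      smul_smul, h2]
    module
  have hab : 2 * a * b = 0 := by
    by_contra hne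
    apply hT
    have e00 := congrFun (congrFun e 0) 0
    have e01 := congrFun (congrFun e 0) 1
    have e10 := congrFun (congrFun e 1) 0
    have e11 := congrFun (congrFun e 1) 1
    simp at e00 e01 e10 e11
    have hne' : a ≠ 0 ∧ b ≠ 0 := by
      constructor <;> rintro rfl <;> simp at hne
    refine ⟨by tauto, by tauto, ?_⟩
    have : (2 * a * b) * (T 0 0 - T 1 1) = 0 := by linear_combination e00 - e11
    exact sub_eq_zero.1 ((mul_eq_zero.1 this).resolve_left hne)
  have e' : a * a + b * b = 1 := by
    rw [hab, zero_smul, add_zero] at e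
    have e00 := congrFun (congrFun e 0) 0
    simpa using e00
  have : a = 0 ∨ b = 0 := by simpa using hab
  rcases this with rfl | rfl
  · have : b = 1 ∨ b = -1 := by
      apply mul_self_eq_one_iff.1; linear_combination e'
    rcases this with rfl | rfl <;> simp
  · have : a = 1 ∨ a = -1 := by
      apply mul_self_eq_one_iff.1; linear_combination e'
    rcases this with rfl | rfl <;> simp

theorem IsSc.add_smul {a b : ℂ} {T : M2} (h : IsSc (a • (1 : M2) + b • T)) (hb : b ≠ 0) : IsSc T := by
  obtain ⟨h1, h2, h3⟩ := h
  simp [hb] at h1 h2 h3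
  exact ⟨h1, h2, h3⟩

theorem isSc_smul_one (a : ℂ) : IsSc (a • (1 : M2)) := by
  simp [IsSc]

theorem comb_eq_zero {a b : ℂ} {T : M2} (hT : ¬ IsSc T) (h : a • (1 : M2) + b • T = 0) :
    a = 0 ∧ b = 0 := by
  have hb : b = 0 := by
    by_contra hb
    apply hT
    apply IsSc.add_smul (a := a) (b := b) _ hb
    rw [h]; simp [IsSc]
  subst hb
  have := congrFun (congrFun h 0) 0
  simp at this
  exact ⟨this, rfl⟩

/-- A nonscalar matrix of finite order has a nondegenerate traceless part. -/
theorem traceless_part {T : M2} (hT : ¬ IsSc T) {k : ℕ} (hk : 0 < k) (hp : T ^ k = 1) :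
    ∃ (c d : ℂ) (X : M2), T = c • (1 : M2) + X ∧ X * X = d • (1 : M2) ∧ d ≠ 0 ∧ ¬ IsSc X := by
  refine ⟨(T 0 0 + T 1 1) / 2, ((T 0 0 - T 1 1) / 2) ^ 2 + T 0 1 * T 1 0,
    T - ((T 0 0 + T 1 1) / 2) • (1 : M2), by abel, ?_, ?_, ?_⟩
  · ext i j
    fin_cases i <;> fin_cases j <;> simp [Matrix.mul_apply, Fin.sum_univ_two] <;> ring
  · intro hd
    set c := (T 0 0 + T 1 1) / 2 with hc
    set X := T - c • (1 : M2) with hX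
    have hXX : X * X = 0 := by
      ext i j
      fin_cases i <;> fin_cases j <;> simp [hX, hc, Matrix.mul_apply, Fin.sum_univ_two]
      · linear_combination hd
      · ring
      · ring
      · linear_combination hd
    have hTX : T = c • (1 : M2) + X := by rw [hX]; abel
    have hXs : ¬ IsSc X := by
      intro h; apply hT
      have : IsSc ((-c) • (1 : M2) + (1:ℂ) • T) := by
        rw [show (-c) • (1 : M2) + (1:ℂ) • T = X by rw [hX]; module]; exact h
      exact this.add_smul one_ne_zero
    have key : ∀ m : ℕ, T ^ (m + 1) = (c ^ (m + 1)) • (1 : M2) + ((m + 1 : ℂ) * c ^ m) • X := by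
      intro m
      induction m with
      | zero => simp [← hTX]
      | succ m ih =>
        rw [pow_succ, ih]
        conv_lhs => rw [hTX]
        simp only [add_mul, mul_add, smul_mul_assoc, mul_smul_comm, one_mul, mul_one, smul_add,
          smul_smul, hXX, smul_zero, add_zero]
        push_cast
        module
    obtain ⟨m, rfl⟩ : ∃ m, k = m + 1 := ⟨k - 1, by omega⟩
    have h1 : (c ^ (m + 1) - 1) • (1 : M2) + ((m + 1 : ℂ) * c ^ m) • X = 0 := by
      rw [sub_smul, one_smul, sub_add_eq_add_sub, ← key, hp, sub_self]
    obtain ⟨h2, h3⟩ := comb_eq_zero hXs h1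
    have hm : (m + 1 : ℂ) ≠ 0 := by exact_mod_cast Nat.succ_ne_zero m
    have h4 : c ^ m = 0 := (mul_eq_zero.1 h3).resolve_left hm
    rw [pow_succ, h4] at h2
    norm_num at h2
  · intro h; apply hT
    have : IsSc ((-((T 0 0 + T 1 1) / 2)) • (1 : M2) + (1:ℂ) • T) := by
      convert h using 1; module
    exact this.add_smul one_ne_zero

theorem conj_sign {c d : ℂ} {X N N' Y : M2} (hXX : X * X = d • (1 : M2)) (hd : d ≠ 0)
    (hXs : ¬ IsSc X) (hN : N' * N = 1) (hN' : N * N' = 1)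
    (hY : Y = N * (c • (1 : M2) + X) * N') (hc : X * Y = Y * X) :
    N * X * N' = X ∨ N * X * N' = - X := by
  obtain ⟨a, b, hab⟩ := comm_nonscalar hXs hc
  have e0 : N * X * N' = (a - c) • (1 : M2) + b • X := by
    have : Y = c • (1 : M2) + N * X * N' := by
      rw [hY, mul_add, add_mul, mul_smul_comm, mul_one, smul_mul_assoc, hN']
    rw [this] at hab
    rw [sub_smul, sub_add_eq_add_sub, ← hab]; abel
  have e1 : (N * X * N') * (N * X * N') = d • (1 : M2) := by
    calc _ = N * (X * (N' * N) * X) * N' := by simp only [mul_assoc]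
      _ = _ := by rw [hN, mul_one, hXX, mul_smul_comm, mul_one, smul_mul_assoc, hN']
  generalize a - c = a' at e0
  have e2 : (a' * a' + b * b * d - d) • (1 : M2) + (2 * a' * b) • X = 0 := by
    rw [sub_smul, sub_add_eq_add_sub, sub_eq_zero, ← e1, e0]
    simp only [add_mul, mul_add, smul_mul_assoc, mul_smul_comm, one_mul, mul_one, smul_add,
      smul_smul, hXX]
    module
  obtain ⟨e3, e4⟩ := comb_eq_zero hXs e2
  have hb : b ≠ 0 := by
    rintro rfl
    apply hXs
    have : X = a' • (1 : M2) := by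
      calc X = (N' * N) * X * (N' * N) := by rw [hN]; simp
        _ = N' * (N * X * N') * N := by simp only [mul_assoc]
        _ = _ := by rw [e0]; simp [hN]
    rw [this]; exact isSc_smul_one _
  have ha : a' = 0 := by simpa [hb] using e4
  subst ha
  have : b * b = 1 := by
    have : (b * b - 1) * d = 0 := by linear_combination e3
    exact sub_eq_zero.1 ((mul_eq_zero.1 this).resolve_right hd)
  rw [e0]
  rcases mul_self_eq_one_iff.1 this with rfl | rfl <;> simp

theorem sq2 {M : Type*} [Group M] [Finite M] (h2 : E2 M) (P : Subgroup M)
    (hP : ∀ x ∈ P, ∀ y ∈ P, x * y = y * x) {n n' : M} (hn : ∀ x ∈ P, n * x * n⁻¹ ∈ P)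
    (hn' : ∀ x ∈ P, n' * x * n'⁻¹ ∈ P) (h : ∃ x ∈ P, n * x ≠ x * n)
    (h' : ∃ x ∈ P, n' * x ≠ x * n') : ∀ x ∈ P, (n * n') * x = x * (n * n') := by
  obtain ⟨σ, hσ⟩ := h2
  have inv1 : ∀ g : M, σ g * σ g⁻¹ = 1 := fun g => by rw [← map_mul]; simp
  have inv2 : ∀ g : M, σ g⁻¹ * σ g = 1 := fun g => by rw [← map_mul]; simp
  obtain ⟨x, hx, hxs⟩ : ∃ x ∈ P, ¬ IsSc (σ x) := by
    obtain ⟨x, hx, hne⟩ := h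
    refine ⟨x, hx, fun hs => hne (hσ ?_)⟩
    rw [map_mul, map_mul, hs.commute]
  obtain ⟨c, d, X, hT, hXX, hd, hXs⟩ := traceless_part hxs (orderOf_pos x)
    (by rw [← map_pow, pow_orderOf_eq_one, map_one])
  have hcx : ∀ y ∈ P, X * σ y = σ y * X := by
    intro y hy
    have h1 : σ x * σ y = σ y * σ x := by rw [← map_mul, ← map_mul, hP x hx y hy]
    rw [hT] at h1
    simpa [add_mul, mul_add] using h1
  have sgn : ∀ m : M, (∀ x ∈ P, m * x * m⁻¹ ∈ P) →
      σ m * X * σ m⁻¹ = X ∨ σ m * X * σ m⁻¹ = - X := by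
    intro m hm
    refine conj_sign (Y := σ (m * x * m⁻¹)) (c := c) hXX hd hXs (inv2 m) (inv1 m) ?_ ?_
    · rw [map_mul, map_mul, hT]
    · exact hcx _ (hm x hx)
  have cent : ∀ m : M, σ m * X * σ m⁻¹ = X → ∀ y ∈ P, m * y = y * m := by
    intro m hm y hy
    apply hσ
    rw [map_mul, map_mul]
    refine comm_of_nonscalar hXs ?_ (hcx y hy)
    calc X * σ m = σ m * X * σ m⁻¹ * σ m := by rw [hm]
      _ = _ := by rw [mul_assoc, inv2, mul_one]
  have a1 : σ n * X * σ n⁻¹ = - X := by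
    refine (sgn n hn).resolve_left fun h1 => ?_
    obtain ⟨y, hy, hne⟩ := h
    exact hne (cent n h1 y hy)
  have a2 : σ n' * X * σ n'⁻¹ = - X := by
    refine (sgn n' hn').resolve_left fun h1 => ?_
    obtain ⟨y, hy, hne⟩ := h'
    exact hne (cent n' h1 y hy)
  apply cent
  calc σ (n * n') * X * σ (n * n')⁻¹ = σ n * (σ n' * X * σ n'⁻¹) * σ n⁻¹ := by
        rw [mul_inv_rev]; simp only [map_mul, mul_assoc]
    _ = X := by rw [a2, mul_neg, neg_mul, a1, neg_neg]

theorem map_eq_one_of_mem_commutator {M A : Type*} [Group M] [CommMonoid A] (f : M →* A) {x : M}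
    (hx : x ∈ commutator M) : f x = 1 := by
  have := Abelianization.commutator_subset_ker f.toHomUnits hx
  rw [MonoidHom.mem_ker] at this
  have := congrArg Units.val this
  simpa using this

theorem transfer_trivial {G : Type*} [Group G] [Finite G] (hp : commutator G = ⊤)
    {p : ℕ} [Fact p.Prime] (P : Sylow p G) {A : Type*} [CommGroup A] (φ : P →* A)
    (hst : ∀ (x : P) (g : G) (h : g⁻¹ * x * g ∈ P), φ ⟨g⁻¹ * x * g, h⟩ = φ x) (x : P) :
    φ x = 1 := by
  classical
  have h1 : MonoidHom.transfer φ (x : G) = 1 :=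
    map_eq_one_of_mem_commutator _ (by rw [hp]; trivial)
  have : Fintype (Quotient (MulAction.orbitRel (Subgroup.zpowers (x : G)) (G ⧸ (P : Subgroup G)))) :=
    Fintype.ofFinite _
  rw [MonoidHom.transfer_eq_prod_quotient_orbitRel_zpowers_quot] at h1
  have h2 : ∀ (k : ℕ) (g : G) (h : g⁻¹ * (x : G) ^ k * g ∈ P), φ ⟨g⁻¹ * (x : G) ^ k * g, h⟩ = φ x ^ k := by
    intro k g h
    rw [← map_pow]
    exact hst (x ^ k) g (by simpa using h)
  have h3 : φ x ^ (P : Subgroup G).index = 1 := by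
    rw [Subgroup.index_eq_sum_minimalPeriod (P : Subgroup G) (x : G), ← Finset.prod_pow_eq_pow_sum, ← h1]
    refine Finset.prod_congr rfl fun q _ => ?_
    rw [h2]
  obtain ⟨k, hk⟩ := P.isPGroup' x
  have h4 : φ x ^ p ^ k = 1 := by rw [← map_pow, hk, map_one]
  have h5 : Nat.Coprime (P : Subgroup G).index (p ^ k) := by
    apply Nat.Coprime.pow_right
    exact ((Nat.Prime.coprime_iff_not_dvd Fact.out).2 P.not_dvd_index).symm
  have := pow_gcd_eq_one.2 ⟨h3, h4⟩
  rwa [Nat.Coprime.gcd_eq_one h5, pow_one] at this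

theorem sylow_bot_of_normalizer_le {G : Type*} [Group G] [Finite G] (hp : commutator G = ⊤)
    {p : ℕ} [Fact p.Prime] (P : Sylow p G)
    (hN : Subgroup.normalizer (P : Set G) ≤ Subgroup.centralizer (P : Set G)) :
    (P : Subgroup G) = ⊥ := by
  have hc : ∀ a b : P, a * b = b * a := fun a b =>
    Subtype.ext (hN (Subgroup.le_normalizer b.2) a a.2)
  let _ : CommGroup P := { (inferInstance : Group P) with mul_comm := hc }
  have : IsMulCommutative P := ⟨⟨hc⟩⟩
  rw [eq_bot_iff]
  intro x hx
  have := transfer_trivial hp P (MonoidHom.id P) (fun x g h => by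
    obtain ⟨n, hn, h'⟩ := P.conj_eq_normalizer_conj_of_mem x g x.2 h
    apply Subtype.ext
    simp only [MonoidHom.id_apply]
    rw [h']
    have := hN hn x x.2
    rw [mul_assoc, this]; simp) ⟨x, hx⟩
  simpa using congrArg Subtype.val this

theorem not_perfect_of_solvable {M : Type*} [Group M] [Nontrivial M] [Group.IsSolvable M] :
    commutator M ≠ ⊤ := (Group.IsSolvable.commutator_lt_top_of_nontrivial M).ne

theorem mm {M : Type*} [Group M] [Finite M] [Nontrivial M]
    (h : ∀ H : Subgroup M, H ≠ ⊤ → ∀ x ∈ H, ∀ y ∈ H, x * y = y * x) : commutator M ≠ ⊤ := by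
  intro hp
  by_cases hall : ∀ (p : ℕ) (_ : Fact p.Prime) (P : Sylow p M), (P : Subgroup M).Normal
  · have : Group.IsNilpotent M := (Group.isNilpotent_of_finite_tfae.out 0 3 rfl rfl).2 hall
    exact not_perfect_of_solvable hp
  · push Not at hall
    obtain ⟨p, _, P, hP⟩ := hall
    have hN : Subgroup.normalizer (P : Set M) ≠ ⊤ := fun hN => hP (Subgroup.normalizer_eq_top_iff.1 hN)
    have := sylow_bot_of_normalizer_le hp P (fun n hn x hx =>
      h _ hN x (Subgroup.le_normalizer hx) n hn)
    rw [this] at hP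
    exact hP inferInstance

theorem E2.scalar {M : Type*} [Group M] {σ : M →* M2} (hσ : Function.Injective σ) {a b c : M}
    (hab : a * b ≠ b * a) (ha : c * a = a * c) (hb : c * b = b * c) : IsSc (σ c) := by
  by_contra hs
  apply hab
  apply hσ
  rw [map_mul, map_mul]
  exact comm_of_nonscalar hs (by rw [← map_mul, ha, map_mul]) (by rw [← map_mul, hb, map_mul])

theorem det_commutator {M : Type*} [Group M] (σ : M →* M2) {c : M} (hc : c ∈ commutator M) :
    (σ c).det = 1 :=
  map_eq_one_of_mem_commutator (Matrix.detMonoidHom.comp σ) hc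

theorem eq_one_of_sq_odd {M : Type*} [Group M] {x : M} (h : x * x = 1) (ho : Odd (orderOf x)) :
    x = 1 := by
  have h2 : orderOf x ∣ 2 := orderOf_dvd_of_pow_eq_one (by rw [pow_two, h])
  have : orderOf x = 1 := by
    rcases (Nat.dvd_prime Nat.prime_two).1 h2 with h | h
    · exact h
    · rw [h] at ho; exact absurd ho (by decide)
  exact orderOf_eq_one_iff.1 this

theorem odd_orderOf {M : Type*} [Group M] (ho : Odd (Nat.card M)) (x : M) : Odd (orderOf x) :=
  ho.of_dvd_nat (orderOf_dvd_natCard x)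

theorem commute_of_sq_odd {M : Type*} [Group M] {n x : M} (h : (n * n) * x = x * (n * n))
    (ho : Odd (orderOf n)) : n * x = x * n := by
  obtain ⟨k, hk⟩ := ho
  have e : n = ((n * n) ^ (k + 1)) := by
    rw [← pow_two, ← pow_mul, show 2 * (k + 1) = orderOf n + 1 by omega, pow_succ,
      pow_orderOf_eq_one, one_mul]
  have : Commute (n * n) x := h
  have := this.pow_left (k + 1)
  rw [← e] at this
  exact this

theorem comm_mem {M : Type*} [Group M] (a b : M) : a * b * a⁻¹ * b⁻¹ ∈ commutator M :=
  Subgroup.commutator_mem_commutator (Subgroup.mem_top a) (Subgroup.mem_top b)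

theorem comm_one {M : Type*} [Group M] {a b : M} (h : a * b * a⁻¹ * b⁻¹ = 1) : a * b = b * a := by
  have : a * b = (a * b * a⁻¹ * b⁻¹) * (b * a) := by group
  rw [this, h, one_mul]

theorem odd_abelian (N : ℕ) : ∀ (M : Type*) [Group M] [Finite M], Nat.card M = N →
    Odd (Nat.card M) → E2 M → ∀ x y : M, x * y = y * x := by
  induction N using Nat.strong_induction_on with
  | _ N ih =>
    intro M _ _ hN ho h2
    by_contra hne
    push Not at hne
    obtain ⟨a, b, hab⟩ := hne
    have : Nontrivial M := ⟨a, 1, by rintro rfl; simp at hab⟩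
    have hsub : ∀ H : Subgroup M, H ≠ ⊤ → ∀ x ∈ H, ∀ y ∈ H, x * y = y * x := by
      intro H hH x hx y hy
      have hlt : Nat.card H < N := by
        rw [← hN]
        exact lt_of_le_of_ne (Subgroup.card_le_card_group H) (fun h => hH (Subgroup.eq_top_of_card_eq H h))
      have := ih _ hlt H rfl (ho.of_dvd_nat H.card_subgroup_dvd_card) (h2.sub H) ⟨x, hx⟩ ⟨y, hy⟩
      exact congrArg Subtype.val this
    have hp := mm hsub
    have hnor : ∀ n : M, ∀ x ∈ commutator M, n * x * n⁻¹ ∈ commutator M :=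
      fun n x hx => Subgroup.Normal.conj_mem inferInstance x hx n
    have hcen : ∀ n : M, ∀ x ∈ commutator M, n * x = x * n := by
      intro n x hx
      by_contra hne
      exact hne (commute_of_sq_odd (sq2 h2 (commutator M) (hsub _ hp) (hnor n) (hnor n)
        ⟨x, hx, hne⟩ ⟨x, hx, hne⟩ x hx) (odd_orderOf ho n))
    obtain ⟨σ, hσ⟩ := h2
    have hc := comm_mem a b
    have hs := E2.scalar hσ hab (hcen a _ hc).symm (hcen b _ hc).symm
    have h1 := det_one_scalar hs (det_commutator σ hc)
    rw [← map_mul, ← map_one σ] at h1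
    have := eq_one_of_sq_odd (hσ h1) (odd_orderOf ho _)
    exact hab (comm_one this)

open Module in
def Irr {M V : Type*} [Group M] [AddCommGroup V] [Module ℂ V] (ρ : M →* Module.End ℂ V) : Prop :=
  ∀ W : Submodule ℂ V, (∀ g, ∀ v ∈ W, ρ g v ∈ W) → W = ⊥ ∨ W = ⊤

section rep
variable {G V : Type*} [Group G] [AddCommGroup V] [Module ℂ V]

theorem rho_inv (ρ : G →* Module.End ℂ V) (g : G) (v : V) : ρ g⁻¹ (ρ g v) = v := by
  rw [← Module.End.mul_apply, ← map_mul]; simp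

theorem rho_inv' (ρ : G →* Module.End ℂ V) (g : G) (v : V) : ρ g (ρ g⁻¹ v) = v := by
  rw [← Module.End.mul_apply, ← map_mul]; simp

theorem rho_mul (ρ : G →* Module.End ℂ V) (g h : G) (v : V) : ρ (g * h) v = ρ g (ρ h v) := by
  rw [map_mul, Module.End.mul_apply]

theorem rho_conj (ρ : G →* Module.End ℂ V) (g x : G) (v : V) :
    ρ x (ρ g v) = ρ g (ρ (g⁻¹ * x * g) v) := by
  rw [← rho_mul, ← rho_mul]; congr 2; group

theorem rho_injective (ρ : G →* Module.End ℂ V) (g : G) : Function.Injective (ρ g) :=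
  Function.LeftInverse.injective (g := ρ g⁻¹) (rho_inv ρ g)

theorem cl_line {ρ : G →* Module.End ℂ V} (hi : Function.Injective ρ) (hr : Irr ρ)
    (N : Subgroup G) [hN : N.Normal] {v : V} (hv : v ≠ 0) (h : ∀ x ∈ N, ∃ c : ℂ, ρ x v = c • v) :
    ∀ x ∈ N, ∀ y ∈ N, x * y = y * x := by
  let W := Submodule.span ℂ {w : V | ∀ x ∈ N, ∃ c : ℂ, ρ x w = c • w}
  have hW : W = ⊥ ∨ W = ⊤ := by
    apply hr
    intro g w hw
    induction hw using Submodule.span_induction with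
    | mem w hw =>
      apply Submodule.subset_span
      intro x hx
      obtain ⟨c, hc⟩ := hw (g⁻¹ * x * g) (by simpa using hN.conj_mem x hx g⁻¹)
      exact ⟨c, by rw [rho_conj, hc, map_smul]⟩
    | zero => simp
    | add a b _ _ ha hb => rw [map_add]; exact W.add_mem ha hb
    | smul c a _ ha => rw [map_smul]; exact W.smul_mem c ha
  have hvW : v ∈ W := Submodule.subset_span h
  rcases hW with hW | hW
  · rw [hW] at hvW; exact absurd (by simpa using hvW) hv
  · intro x hx y hy
    apply hi
    apply LinearMap.ext_on hW
    intro w hw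
    obtain ⟨c, hc⟩ := hw x hx
    obtain ⟨d, hd⟩ := hw y hy
    rw [rho_mul, rho_mul, hc, hd, map_smul, map_smul, hc, hd, smul_comm]

theorem cl_vec {ρ : G →* Module.End ℂ V} (hd : Module.finrank ℂ V = 3) (hr : Irr ρ)
    (N : Subgroup G) [hN : N.Normal] (hred : ¬ Irr (ρ.comp N.subtype)) :
    ∃ v : V, v ≠ 0 ∧ ∀ x ∈ N, ∃ c : ℂ, ρ x v = c • v := by
  have : FiniteDimensional ℂ V := Module.finite_of_finrank_pos (by omega)
  have key : ∀ U : Submodule ℂ V, (∀ x ∈ N, ∀ v ∈ U, ρ x v ∈ U) → Module.finrank ℂ U = 1 →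
      ∃ v : V, v ≠ 0 ∧ ∀ x ∈ N, ∃ c : ℂ, ρ x v = c • v := by
    intro U hU h1
    obtain ⟨v, hv, h⟩ := finrank_eq_one_iff'.1 h1
    refine ⟨v, by simpa using hv, fun x hx => ?_⟩
    obtain ⟨c, hc⟩ := h ⟨ρ x v, hU x hx v v.2⟩
    exact ⟨c, by simpa using (congrArg Subtype.val hc).symm⟩
  unfold Irr at hred
  push Not at hred
  obtain ⟨W, hW, hb, ht⟩ := hred
  have hW' : ∀ x ∈ N, ∀ v ∈ W, ρ x v ∈ W := fun x hx v hv => hW ⟨x, hx⟩ v hv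
  have hlt : Module.finrank ℂ W < 3 := by rw [← hd]; exact Submodule.finrank_lt ht
  have hpos : Module.finrank ℂ W ≠ 0 := fun h => hb (Submodule.finrank_eq_zero.1 h)
  by_cases h1 : Module.finrank ℂ W = 1
  · exact key W hW' h1
  have h2 : Module.finrank ℂ W = 2 := by omega
  have : ∃ g, W.map (ρ g) ≠ W := by
    by_contra hc
    push Not at hc
    rcases hr W (fun g v hv => by rw [← hc g]; exact Submodule.mem_map_of_mem hv) with h | h
    · exact hb h
    · exact ht h
  obtain ⟨g, hg⟩ := this
  have hf : Module.finrank ℂ (W.map (ρ g)) = 2 := by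
    rw [← h2]
    exact (Submodule.equivMapOfInjective (ρ g) (rho_injective ρ g) W).finrank_eq.symm
  have hsum := Submodule.finrank_sup_add_finrank_inf_eq W (W.map (ρ g))
  have hle : Module.finrank ℂ ↥(W ⊔ W.map (ρ g)) ≤ 3 := by rw [← hd]; exact Submodule.finrank_le _
  apply key (W ⊓ W.map (ρ g))
  · rintro x hx v ⟨hv, w, hw, rfl⟩
    refine ⟨hW' x hx _ hv, ?_⟩
    rw [rho_conj]
    exact Submodule.mem_map_of_mem (hW' _ (by simpa using hN.conj_mem x hx g⁻¹) w hw)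
  · have : Module.finrank ℂ ↥(W ⊓ W.map (ρ g)) ≠ 2 := by
      intro h
      have e1 : W ⊓ W.map (ρ g) = W := Submodule.eq_of_le_of_finrank_eq inf_le_left (by rw [h, h2])
      have e2 : W ⊓ W.map (ρ g) = W.map (ρ g) := Submodule.eq_of_le_of_finrank_eq inf_le_right (by rw [h, hf])
      exact hg (e2.symm.trans e1)
    have : Module.finrank ℂ ↥(W ⊓ W.map (ρ g)) ≤ 2 := by
      rw [← h2]; exact Submodule.finrank_mono inf_le_left
    omega

theorem clifford {ρ : G →* Module.End ℂ V} (hi : Function.Injective ρ)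
    (hd : Module.finrank ℂ V = 3) (hr : Irr ρ)
    (N : Subgroup G) [hN : N.Normal] (hred : ¬ Irr (ρ.comp N.subtype)) :
    ∀ x ∈ N, ∀ y ∈ N, x * y = y * x := by
  obtain ⟨v, hv, h⟩ := cl_vec hd hr N hred
  exact cl_line hi hr N hv h

theorem schur {ρ : G →* Module.End ℂ V} (hd : Module.finrank ℂ V = 3) (hr : Irr ρ)
    (T : Module.End ℂ V) (hT : ∀ g v, T (ρ g v) = ρ g (T v)) : ∃ c : ℂ, ∀ v, T v = c • v := by
  have : FiniteDimensional ℂ V := Module.finite_of_finrank_pos (by omega)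
  have : Nontrivial V := Module.nontrivial_of_finrank_pos (R := ℂ) (by omega)
  obtain ⟨c, hc⟩ := Module.End.exists_eigenvalue T
  rcases hr (T.eigenspace c) (fun g v hv => by
    rw [Module.End.mem_eigenspace_iff] at hv ⊢
    rw [hT, hv, map_smul]) with h | h
  · exact absurd h hc
  · refine ⟨c, fun v => ?_⟩
    have : v ∈ T.eigenspace c := by rw [h]; trivial
    exact Module.End.mem_eigenspace_iff.1 this

theorem central_scalar {ρ : G →* Module.End ℂ V} (hd : Module.finrank ℂ V = 3) (hr : Irr ρ)
    {z : G} (hz : ∀ g, z * g = g * z) : ∃ c : ℂ, ∀ v, ρ z v = c • v :=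
  schur hd hr _ fun g v => by rw [← rho_mul, hz, rho_mul]

theorem irr_nonab {ρ : G →* Module.End ℂ V} (hd : Module.finrank ℂ V = 3) (hr : Irr ρ) :
    ∃ a b : G, a * b ≠ b * a := by
  by_contra hc
  push Not at hc
  have : Nontrivial V := Module.nontrivial_of_finrank_pos (R := ℂ) (by omega)
  obtain ⟨v, hv⟩ := exists_ne (0 : V)
  rcases hr (Submodule.span ℂ {v}) (fun g w hw => by
    obtain ⟨c, h⟩ := central_scalar (z := g) hd hr (hc g)
    rw [h]; exact Submodule.smul_mem _ _ hw) with h | h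
  · exact hv (by simpa using h)
  · have := finrank_span_singleton (K := ℂ) hv
    rw [h, finrank_top, hd] at this
    omega

theorem central_invol {ρ : G →* Module.End ℂ V} (hi : Function.Injective ρ)
    (hd : Module.finrank ℂ V = 3) (hr : Irr ρ)
    {z : G} (hz : ∀ g, z * g = g * z) (h2 : z * z = 1) (hc : z ∈ commutator G) : z = 1 := by
  have : Nontrivial V := Module.nontrivial_of_finrank_pos (R := ℂ) (by omega)
  obtain ⟨c, h⟩ := central_scalar hd hr hz
  have hT : ρ z = c • 1 := LinearMap.ext fun v => by simp [h]
  have hdet : LinearMap.det (ρ z) = 1 := map_eq_one_of_mem_commutator (LinearMap.det.comp ρ) hc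
  rw [hT, LinearMap.det_smul, hd] at hdet
  simp only [map_one, mul_one] at hdet
  obtain ⟨v, hv⟩ := exists_ne (0 : V)
  have hcc : c * c = 1 := by
    have : ρ (z * z) v = v := by rw [h2]; simp
    rw [rho_mul, h, h, smul_smul] at this
    have h' : (c * c - 1) • v = 0 := by rw [sub_smul, this, one_smul, sub_self]
    rcases smul_eq_zero.1 h' with h | h
    · exact sub_eq_zero.1 h
    · exact absurd h hv
  have hc1 : c = 1 := by linear_combination hdet - c * hcc
  apply hi
  rw [hT, hc1, one_smul, map_one]

end rep

theorem L1 {V : Type*} [AddCommGroup V] [Module ℂ V] (hd : Module.finrank ℂ V = 3) (N : ℕ) :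
    ∀ (M : Type*) [Group M] [Finite M], Nat.card M = N → E2 M → ∀ ρ : M →* Module.End ℂ V,
    Function.Injective ρ → ¬ Irr ρ := by
  induction N using Nat.strong_induction_on with
  | _ N ih =>
    intro M _ _ hN h2 ρ hi hr
    have hsub : ∀ H : Subgroup M, H ≠ ⊤ → ¬ Irr (ρ.comp H.subtype) := by
      intro H hH
      have hlt : Nat.card H < N := by
        rw [← hN]
        exact lt_of_le_of_ne (Subgroup.card_le_card_group H) (fun h => hH (Subgroup.eq_top_of_card_eq H h))
      exact ih _ hlt H rfl (h2.sub H) _ (hi.comp H.subtype_injective)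
    have hnor : ∀ n : M, ∀ x ∈ commutator M, n * x * n⁻¹ ∈ commutator M :=
      fun n x hx => Subgroup.Normal.conj_mem inferInstance x hx n
    obtain ⟨a, b, hab⟩ := irr_nonab hd hr
    by_cases hp : commutator M = ⊤
    · have hev : ¬ Odd (Nat.card M) := fun ho => hab (odd_abelian _ M rfl ho h2 a b)
      rw [Nat.not_odd_iff_even, even_iff_two_dvd] at hev
      have : Fact (Nat.Prime 2) := ⟨Nat.prime_two⟩
      obtain ⟨s, hs⟩ := exists_prime_orderOf_dvd_card' 2 hev
      have hss : s * s = 1 := by rw [← pow_two, ← hs, pow_orderOf_eq_one]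
      have hs1 : s ≠ 1 := by rintro rfl; simp at hs
      obtain ⟨σ, hσ⟩ := h2
      have hsc : s ∈ commutator M := by rw [hp]; trivial
      have hm : σ s = -1 := by
        rcases sl_invol (T := σ s) (by rw [← map_mul, hss, map_one]) (det_commutator σ hsc) with h | h
        · exact absurd (hσ (h.trans (map_one σ).symm)) hs1
        · exact h
      refine hs1 (central_invol hi hd hr (fun g => hσ ?_) hss hsc)
      rw [map_mul, map_mul, hm]; simp
    · have hab' := clifford hi hd hr (commutator M) (hsub _ hp)
      by_cases hC : Subgroup.centralizer (commutator M : Set M) = ⊤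
      · have hcen : ∀ n : M, ∀ x ∈ commutator M, n * x = x * n := by
          intro n x hx
          have : n ∈ Subgroup.centralizer (commutator M : Set M) := by rw [hC]; trivial
          exact (this x hx).symm
        have hc := comm_mem a b
        obtain ⟨σ, hσ⟩ := h2
        have hs := E2.scalar hσ hab (hcen a _ hc).symm (hcen b _ hc).symm
        have h1 := det_one_scalar hs (det_commutator σ hc)
        rw [← map_mul, ← map_one σ] at h1
        exact hab (comm_one (central_invol hi hd hr (fun g => (hcen g _ hc).symm) (hσ h1) hc))
      · set C := Subgroup.centralizer (commutator M : Set M) with hCdef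
        have hCn : C.Normal := inferInstance
        obtain ⟨v, hv, h⟩ := cl_vec hd hr C (hsub _ hC)
        have hnc : ∀ t, t ∉ C → ∃ x ∈ commutator M, t * x ≠ x * t := by
          intro t ht
          by_contra hc
          push Not at hc
          exact ht (fun x hx => (hc x hx).symm)
        have hmul : ∀ n n', n ∉ C → n' ∉ C → n * n' ∈ C := by
          intro n n' hn hn' x hx
          exact (sq2 h2 (commutator M) hab' (hnor n) (hnor n') (hnc n hn) (hnc n' hn') x hx).symm
        obtain ⟨t, ht⟩ : ∃ t, t ∉ C := by
          by_contra hc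
          push Not at hc
          exact hC (by rw [eq_top_iff]; exact fun x _ => hc x)
        let W := Submodule.span ℂ ({v, ρ t v} : Set V)
        have hvW : v ∈ W := Submodule.subset_span (by simp)
        have htvW : ρ t v ∈ W := Submodule.subset_span (by simp)
        have hgen : ∀ g : M, ρ g v ∈ W → ρ g (ρ t v) ∈ W → ∀ w ∈ W, ρ g w ∈ W := by
          intro g h1 h2 w hw
          obtain ⟨a, b, rfl⟩ := Submodule.mem_span_pair.1 hw
          rw [map_add, map_smul, map_smul]
          exact W.add_mem (W.smul_mem _ h1) (W.smul_mem _ h2)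
        have hWC : ∀ g ∈ C, ∀ w ∈ W, ρ g w ∈ W := by
          intro g hg
          apply hgen
          · obtain ⟨c, hc⟩ := h g hg
            rw [hc]; exact W.smul_mem _ hvW
          · obtain ⟨c, hc⟩ := h (t⁻¹ * g * t) (by simpa using hCn.conj_mem g hg t⁻¹)
            rw [rho_conj, hc, map_smul]; exact W.smul_mem _ htvW
        have hWt : ∀ w ∈ W, ρ t w ∈ W := by
          apply hgen t htvW
          obtain ⟨c, hc⟩ := h (t * t) (hmul t t ht ht)
          rw [← rho_mul, hc]; exact W.smul_mem _ hvW
        have hW : ∀ g, ∀ w ∈ W, ρ g w ∈ W := by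
          intro g w hw
          by_cases hg : g ∈ C
          · exact hWC g hg w hw
          · have : g = t * (t⁻¹ * g) := by group
            rw [this, rho_mul]
            exact hWt _ (hWC _ (hmul _ _ (fun h => ht (by simpa using C.inv_mem h)) hg) w hw)
        rcases hr W hW with h | h
        · rw [h] at hvW; exact hv (by simpa using hvW)
        · classical
          have := finrank_span_finset_le_card (R := ℂ) ({v, ρ t v} : Finset V)
          have h3 : ({v, ρ t v} : Finset V).card ≤ 2 := Finset.card_le_two
          have e : (Submodule.span ℂ (({v, ρ t v} : Finset V) : Set V)) = ⊤ := by
            rw [← h]; simp [W]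
          rw [Set.finrank, e, finrank_top, hd] at this
          omega

structure Ctx {G V : Type*} [Group G] [AddCommGroup V] [Module ℂ V]
    (ρ : G →* Module.End ℂ V) : Prop where
  perf : commutator G = ⊤
  inj : Function.Injective ρ
  dim : Module.finrank ℂ V = 3
  irr : Irr ρ
  e2 : ∀ H : Subgroup G, H ≠ ⊤ → E2 H

theorem perm3_aux : ∀ a b : Equiv.Perm (Fin 3), Equiv.Perm.sign a = 1 → Equiv.Perm.sign b = 1 →
    a * b = b * a := by decide

theorem perm3 {G : Type*} [Group G] (hp : commutator G = ⊤) (f : G →* Equiv.Perm (Fin 3)) (g : G) :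
    f g = 1 := by
  have h1 : ∀ g, Equiv.Perm.sign (f g) = 1 := fun g =>
    map_eq_one_of_mem_commutator (Equiv.Perm.sign.comp f) (by rw [hp]; trivial)
  have h2 : commutator G ≤ f.ker := by
    rw [commutator_def, Subgroup.commutator_le]
    intro a _ b _
    rw [MonoidHom.mem_ker]
    change f (a * b * a⁻¹ * b⁻¹) = 1
    rw [map_mul, map_mul, map_mul, perm3_aux _ _ (h1 a) (h1 b), ← map_mul, ← map_mul, ← map_mul]
    simp
  exact h2 (by rw [hp]; trivial)

section
variable {G V : Type*} [Group G] [AddCommGroup V] [Module ℂ V]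

def wsp (ρ : G →* Module.End ℂ V) (A : Subgroup G) (χ : A → ℂ) : Submodule ℂ V :=
  ⨅ x : A, (ρ x).eigenspace (χ x)

theorem mem_wsp {ρ : G →* Module.End ℂ V} {A : Subgroup G} {χ : A → ℂ} {v : V} :
    v ∈ wsp ρ A χ ↔ ∀ x : A, ρ x v = χ x • v := by
  simp [wsp]

theorem wsp_conj {ρ : G →* Module.End ℂ V} {A : Subgroup G} [hA : A.Normal] {χ : A → ℂ} {v : V} (g : G)
    (hv : v ∈ wsp ρ A χ) : ρ g v ∈ wsp ρ A (fun x => χ (MulAut.conjNormal g⁻¹ x)) := by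
  rw [mem_wsp] at hv ⊢
  intro x
  have := hv (MulAut.conjNormal g⁻¹ x)
  rw [MulAut.conjNormal_apply, inv_inv] at this
  rw [rho_conj, this, map_smul]

theorem wsp_conj_ne {ρ : G →* Module.End ℂ V} {A : Subgroup G} [hA : A.Normal] {χ : A → ℂ} (g : G)
    (h : wsp ρ A χ ≠ ⊥) : wsp ρ A (fun x => χ (MulAut.conjNormal g⁻¹ x)) ≠ ⊥ := by
  obtain ⟨v, hv, h0⟩ := Submodule.exists_mem_ne_zero_of_ne_bot h
  intro hb
  have := wsp_conj g hv
  rw [hb, Submodule.mem_bot] at this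
  exact h0 (rho_injective ρ g (by simpa using this))

theorem lemN {ρ : G →* Module.End ℂ V} (c : Ctx ρ) (A : Subgroup G) [hA : A.Normal]
    (hab : ∀ x ∈ A, ∀ y ∈ A, x * y = y * x) : ∀ x ∈ A, ∀ g, x * g = g * x := by
  have hd := c.dim
  have : FiniteDimensional ℂ V := Module.finite_of_finrank_pos (by omega)
  have hred : ¬ Irr (ρ.comp A.subtype) := fun h => by
    obtain ⟨a, b, hne⟩ := irr_nonab c.dim h
    exact hne (Subtype.ext (hab a a.2 b b.2))
  obtain ⟨v, hv0, hv⟩ := cl_vec c.dim c.irr A hred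
  have hind : iSupIndep (wsp ρ A) := by
    have := Module.End.independent_iInf_maxGenEigenspace_of_forall_mapsTo (fun x : A => ρ x)
      (fun x y φ => Module.End.mapsTo_maxGenEigenspace_of_comm
        (show Commute (ρ y) (ρ x) by
          rw [commute_iff_eq, ← map_mul, hab y y.2 x x.2, map_mul]) φ)
    refine this.mono fun χ => ?_
    exact iInf_mono fun x => (Module.End.genEigenspace (ρ x) (χ x)).mono le_top
  have hfin : Finite {χ // wsp ρ A χ ≠ ⊥} := by
    have := hind.fintypeNeBotOfFiniteDimensional
    exact Finite.of_fintype _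
  have : Fintype {χ // wsp ρ A χ ≠ ⊥} := Fintype.ofFinite _
  have hcard := hind.subtype_ne_bot_le_finrank
  rw [hd] at hcard
  let act : MulAction G {χ // wsp ρ A χ ≠ ⊥} :=
    { smul := fun g χ => ⟨fun x => χ.1 (MulAut.conjNormal g⁻¹ x), wsp_conj_ne g χ.2⟩
      one_smul := fun χ => Subtype.ext (funext fun x => by
        change χ.1 (MulAut.conjNormal 1⁻¹ x) = χ.1 x
        simp)
      mul_smul := fun g h χ => Subtype.ext (funext fun x => by
        change χ.1 (MulAut.conjNormal (g * h)⁻¹ x) =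
          χ.1 (MulAut.conjNormal h⁻¹ (MulAut.conjNormal g⁻¹ x))
        rw [mul_inv_rev, map_mul, MulAut.mul_apply]) }
  obtain ⟨ι⟩ : Nonempty ({χ // wsp ρ A χ ≠ ⊥} ↪ Fin 3) :=
    Function.Embedding.nonempty_of_card_le (by simpa using hcard)
  have htriv : ∀ g : G, ∀ χ : {χ // wsp ρ A χ ≠ ⊥}, g • χ = χ := by
    intro g χ
    have h1 := perm3 c.perf ((Equiv.Perm.viaEmbeddingHom ι).comp (MulAction.toPermHom G _)) g
    have h2 : MulAction.toPermHom G {χ // wsp ρ A χ ≠ ⊥} g = 1 :=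
      Equiv.Perm.viaEmbeddingHom_injective ι (by simpa using h1)
    exact congrFun (congrArg DFunLike.coe h2) χ
  choose χ hχ using fun x : A => hv x x.2
  have hvw : v ∈ wsp ρ A χ := mem_wsp.2 hχ
  have hne : wsp ρ A χ ≠ ⊥ := fun h => hv0 (by rw [h] at hvw; simpa using hvw)
  rcases c.irr (wsp ρ A χ) (fun g w hw => by
    have h1 := wsp_conj g hw
    have h2 := congrArg Subtype.val (htriv g ⟨χ, hne⟩)
    change (fun x => χ (MulAut.conjNormal g⁻¹ x)) = χ at h2
    rwa [h2] at h1) with h | h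
  · exact absurd h hne
  · intro x hx g
    apply c.inj
    ext w
    have hw : ∀ w, ρ x w = χ ⟨x, hx⟩ • w := fun w => by
      have : w ∈ wsp ρ A χ := by rw [h]; trivial
      exact mem_wsp.1 this ⟨x, hx⟩
    rw [rho_mul, rho_mul, hw, hw, map_smul]

theorem sq2H [Finite G] (H : Subgroup G) (h2 : E2 H) (P : Subgroup G) (hPH : P ≤ H)
    (hP : ∀ x ∈ P, ∀ y ∈ P, x * y = y * x) {n n' : G} (hnH : n ∈ H) (hnH' : n' ∈ H)
    (hn : ∀ x ∈ P, n * x * n⁻¹ ∈ P)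
    (hn' : ∀ x ∈ P, n' * x * n'⁻¹ ∈ P) (h : ∃ x ∈ P, n * x ≠ x * n)
    (h' : ∃ x ∈ P, n' * x ≠ x * n') : ∀ x ∈ P, (n * n') * x = x * (n * n') := by
  intro x hx
  have := sq2 h2 (P.subgroupOf H)
    (fun x hx y hy => Subtype.ext (hP x hx y hy)) (n := ⟨n, hnH⟩) (n' := ⟨n', hnH'⟩)
    (fun x hx => hn x hx) (fun x hx => hn' x hx)
    (by
      obtain ⟨x, hx, hne⟩ := h
      exact ⟨⟨x, hPH hx⟩, hx, fun e => hne (congrArg Subtype.val e)⟩)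
    (by
      obtain ⟨x, hx, hne⟩ := h'
      exact ⟨⟨x, hPH hx⟩, hx, fun e => hne (congrArg Subtype.val e)⟩) ⟨x, hPH hx⟩ hx
  exact congrArg Subtype.val this

theorem D1 [Finite G] {ρ : G →* Module.End ℂ V} (c : Ctx ρ) (P : Subgroup G)
    (hP : ∀ x ∈ P, ∀ y ∈ P, x * y = y * x) {n n' : G}
    (hn : ∀ x ∈ P, n * x * n⁻¹ ∈ P)
    (hn' : ∀ x ∈ P, n' * x * n'⁻¹ ∈ P) (h : ∃ x ∈ P, n * x ≠ x * n)
    (h' : ∃ x ∈ P, n' * x ≠ x * n') : ∀ x ∈ P, (n * n') * x = x * (n * n') := by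
  by_cases hN : Subgroup.normalizer (P : Set G) = ⊤
  · have : P.Normal := Subgroup.normalizer_eq_top_iff.1 hN
    obtain ⟨x, hx, hne⟩ := h
    exact absurd (lemN c P hP x hx n).symm hne
  · exact sq2H _ (c.e2 _ hN) P Subgroup.le_normalizer hP
      (Subgroup.mem_normalizer_fintype hn) (Subgroup.mem_normalizer_fintype hn') hn hn' h h'

theorem D1sq [Finite G] {ρ : G →* Module.End ℂ V} (c : Ctx ρ) (P : Subgroup G)
    (hP : ∀ x ∈ P, ∀ y ∈ P, x * y = y * x) {n : G}
    (hn : ∀ x ∈ P, n * x * n⁻¹ ∈ P) : ∀ x ∈ P, (n * n) * x = x * (n * n) := by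
  by_cases h : ∃ x ∈ P, n * x ≠ x * n
  · exact D1 c P hP hn hn h h
  · push Not at h
    intro x hx
    rw [mul_assoc, h x hx, ← mul_assoc, h x hx, mul_assoc]

end

section
variable {G V : Type*} [Group G] [AddCommGroup V] [Module ℂ V]

theorem Ctx.nontriv {ρ : G →* Module.End ℂ V} (c : Ctx ρ) : Nontrivial G := by
  obtain ⟨a, b, hab⟩ := irr_nonab c.dim c.irr
  exact ⟨a, 1, by rintro rfl; simp at hab⟩

theorem Ctx.pgroup_ne_top [Finite G] {ρ : G →* Module.End ℂ V} (c : Ctx ρ) {p : ℕ} [Fact p.Prime]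
    {P : Subgroup G} (hP : IsPGroup p P) : P ≠ ⊤ := by
  rintro rfl
  have := c.nontriv
  have h : IsPGroup p G := hP.of_equiv Subgroup.topEquiv
  have : Group.IsNilpotent G := h.isNilpotent
  exact not_perfect_of_solvable c.perf

theorem sylow_odd [Finite G] {p : ℕ} [Fact p.Prime] (hp : p ≠ 2) {P : Subgroup G} (hP : IsPGroup p P) :
    Odd (Nat.card P) := by
  obtain ⟨n, hn⟩ := IsPGroup.iff_card.1 hP
  rw [hn]
  exact (Nat.Prime.odd_of_ne_two Fact.out hp).pow

theorem Ctx.pgroup_comm [Finite G] {ρ : G →* Module.End ℂ V} (c : Ctx ρ) {p : ℕ} [Fact p.Prime]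
    (hp : p ≠ 2) {P : Subgroup G} (hP : IsPGroup p P) : ∀ x ∈ P, ∀ y ∈ P, x * y = y * x := by
  intro x hx y hy
  have := odd_abelian _ P rfl (sylow_odd hp hP) (c.e2 _ (c.pgroup_ne_top hP)) ⟨x, hx⟩ ⟨y, hy⟩
  exact congrArg Subtype.val this

theorem D2 [Finite G] {ρ : G →* Module.End ℂ V} (c : Ctx ρ) {p : ℕ} [Fact p.Prime]
    (hp : p ≠ 2) (P : Sylow p G) (hb : (P : Subgroup G) ≠ ⊥) :
    ∃ s, ∀ x ∈ P, s * x * s⁻¹ = x⁻¹ := by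
  have hc' := c.pgroup_comm hp P.isPGroup'
  have hN : ¬ Subgroup.normalizer (P : Set G) ≤ Subgroup.centralizer (P : Set G) :=
    fun h => hb (sylow_bot_of_normalizer_le c.perf P h)
  obtain ⟨s, hs, hsc⟩ := SetLike.not_le_iff_exists.1 hN
  have hnc : ∀ t, t ∉ Subgroup.centralizer (P : Set G) → ∃ x ∈ (P : Subgroup G), t * x ≠ x * t := by
    intro t ht
    by_contra hc
    push Not at hc
    exact ht (fun x hx => (hc x hx).symm)
  have hs' : ∀ x ∈ P, s * x * s⁻¹ ∈ P := fun x hx => (hs x).1 hx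
  have hc : ∀ a b : P, a * b = b * a := fun a b => Subtype.ext (hc' a a.2 b b.2)
  let _ : CommGroup P := { (inferInstance : Group P) with mul_comm := hc }
  have : IsMulCommutative P := ⟨⟨hc⟩⟩
  let φ : P →* P := MonoidHom.mk' (fun x => x * ⟨s * x * s⁻¹, hs' x x.2⟩) (by
    intro a b
    have e : (⟨s * (a * b : P) * s⁻¹, hs' _ (a * b).2⟩ : P) =
        ⟨s * a * s⁻¹, hs' a a.2⟩ * ⟨s * b * s⁻¹, hs' b b.2⟩ := Subtype.ext (by
          change s * (a * b : G) * s⁻¹ = (s * a * s⁻¹) * (s * b * s⁻¹)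
          group)
    rw [e]
    exact mul_mul_mul_comm _ _ _ _)
  refine ⟨s, fun x hx => ?_⟩
  have h1 : φ ⟨x, hx⟩ = 1 := by
    apply transfer_trivial c.perf P φ
    intro x g h
    obtain ⟨n, hn, h'⟩ := P.conj_eq_normalizer_conj_of_mem x g x.2 h
    apply Subtype.ext
    change (g⁻¹ * x * g : G) * (s * (g⁻¹ * x * g) * s⁻¹) = x * (s * x * s⁻¹)
    rw [h']
    by_cases hnC : n ∈ Subgroup.centralizer (P : Set G)
    · have e : n⁻¹ * x * n = x := by
        have := hnC x x.2
        rw [mul_assoc, this]; simp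
      rw [e]
    · have hn1 : n⁻¹ ∈ Subgroup.normalizer (P : Set G) := inv_mem hn
      have hnC1 : n⁻¹ ∉ Subgroup.centralizer (P : Set G) := fun h => hnC (by simpa using inv_mem h)
      have e1 := D1 c P hc' hs' (fun x hx => (hn1 x).1 hx) (hnc s hsc) (hnc _ hnC1) x x.2
      have e2 := D1 c P hc' hs' hs' (hnc s hsc) (hnc s hsc) x x.2
      have e3 : s * (n⁻¹ * x * n) * s⁻¹ = x := by
        have : s * (n⁻¹ * x * n) * s⁻¹ = (s * n⁻¹ * x) * n * s⁻¹ := by group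
        rw [this, e1]; group
      have e4 : n⁻¹ * x * n = s * x * s⁻¹ := by
        have : n⁻¹ * (x : G) * n = s⁻¹ * (s * (n⁻¹ * x * n) * s⁻¹) * s := by group
        rw [this, e3]
        have : s⁻¹ * (x : G) * s = s⁻¹ * (x * (s * s)) * s⁻¹ := by group
        rw [this, ← e2]; group
      rw [e3, e4]
      have hh := hc' x x.2 (s * x * s⁻¹) (hs' x x.2)
      exact hh.symm
  have h2 : x * (s * x * s⁻¹) = 1 := congrArg Subtype.val h1
  exact (inv_eq_of_mul_eq_one_right h2).symm

theorem isPGroup_zpowers [Finite G] {p k : ℕ} [Fact p.Prime] {x : G} (h : orderOf x = p ^ k) :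
    IsPGroup p (Subgroup.zpowers x) := by
  apply IsPGroup.of_card (n := k); rw [Nat.card_zpowers, h]

theorem D2' [Finite G] {ρ : G →* Module.End ℂ V} (c : Ctx ρ) {p : ℕ} [Fact p.Prime]
    (hp : p ≠ 2) {x : G} (hx : orderOf x = p) : ∃ s, s * x * s⁻¹ = x⁻¹ := by
  obtain ⟨P, hP⟩ := (isPGroup_zpowers (k := 1) (by rw [hx, pow_one])).exists_le_sylow
  have hxP : x ∈ (P : Subgroup G) := hP (Subgroup.mem_zpowers x)
  obtain ⟨s, hs⟩ := D2 c hp P (fun hb => by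
    rw [hb, Subgroup.mem_bot] at hxP
    rw [hxP, orderOf_one] at hx
    exact (Fact.out : p.Prime).one_lt.ne hx)
  exact ⟨s, hs x hxP⟩

theorem D3 [Finite G] {ρ : G →* Module.End ℂ V} (c : Ctx ρ) {p : ℕ} [hpp : Fact p.Prime]
    (hp : p ≠ 2) {x : G} (hx : orderOf x = p) :
    ∃ (b : Module.Basis (Fin 3) ℂ V) (μ : Fin 3 → ℂ), Function.Injective μ ∧ μ 0 = 1 ∧
      ∀ i, ρ x (b i) = μ i • b i := by
  obtain ⟨s, hs⟩ := D2' c hp hx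
  have hs' : s⁻¹ * x * s = x⁻¹ := by
    have h1 : x = s * x⁻¹ * s⁻¹ := by
      have := congrArg (·⁻¹) hs
      simpa [mul_assoc] using this.symm
    calc s⁻¹ * x * s = s⁻¹ * (s * x⁻¹ * s⁻¹) * s := by rw [← h1]
      _ = x⁻¹ := by group
  have hd := c.dim
  have : FiniteDimensional ℂ V := Module.finite_of_finrank_pos (by omega)
  have hp0 : (p : ℂ) ≠ 0 := by exact_mod_cast hpp.out.ne_zero
  have hdetg : ∀ g, LinearMap.det (ρ g) = 1 := fun g =>
    map_eq_one_of_mem_commutator (LinearMap.det.comp ρ) (by rw [c.perf]; trivial)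
  have hxp : ∀ v, (ρ x ^ p) v = v := fun v => by
    rw [← map_pow, ← hx, pow_orderOf_eq_one]; simp
  -- eigenvalue one
  have hdet : LinearMap.det (1 - ρ x) = 0 := by
    have e1 : ρ s⁻¹ * (1 - ρ x) * ρ s = 1 - ρ x⁻¹ := by
      rw [mul_sub, sub_mul, mul_one, ← map_mul, ← map_mul, ← map_mul, hs']; simp
    have e2 : (1 - ρ x⁻¹) = (-1 : ℂ) • (ρ x⁻¹ * (1 - ρ x)) := by
      rw [mul_sub, ← map_mul]; simp
    have e3 := congrArg LinearMap.det e1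
    rw [e2, LinearMap.det_smul, map_mul, map_mul, map_mul, hdetg, hdetg, hdetg, hd] at e3
    have e4 : LinearMap.det (1 - ρ x) = - LinearMap.det (1 - ρ x) := by
      linear_combination e3
    linear_combination e4 / 2
  obtain ⟨v0, hv0m, hv0⟩ := Submodule.exists_mem_ne_zero_of_ne_bot
    (LinearMap.bot_lt_ker_of_det_eq_zero hdet).ne'
  have hv0x : ρ x v0 = v0 := by
    rw [LinearMap.mem_ker, LinearMap.sub_apply, sub_eq_zero] at hv0m
    exact hv0m.symm
  -- eigenvector in the range
  have hx1 : x ≠ 1 := by rintro rfl; rw [orderOf_one] at hx; exact hpp.out.one_lt.ne hx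
  have hne : ρ x ≠ 1 := fun h => hx1 (c.inj (h.trans (map_one ρ).symm))
  let U := LinearMap.range (ρ x - 1)
  have hU : ∀ v ∈ U, ρ x v ∈ U := by
    rintro _ ⟨w, rfl⟩
    exact ⟨ρ x w, by simp⟩
  have hUb : U ≠ ⊥ := fun h => hne (sub_eq_zero.1 (LinearMap.range_eq_bot.1 h))
  have : Nontrivial U := Submodule.nontrivial_iff_ne_bot.2 hUb
  obtain ⟨ζ, hζ⟩ := Module.End.exists_eigenvalue ((ρ x).restrict hU)
  obtain ⟨⟨v1, w, hw⟩, hv1⟩ := hζ.exists_hasEigenvector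
  have hv10 : v1 ≠ 0 := fun h => hv1.2 (Subtype.ext h)
  have hv1x : ρ x v1 = ζ • v1 := congrArg Subtype.val hv1.apply_eq_smul
  have hw' : ρ x w = w + v1 := by rw [← hw]; simp
  have hpow : ∀ k : ℕ, (ρ x ^ k) v1 = ζ ^ k • v1 := by
    intro k
    induction k with
    | zero => simp
    | succ k ih => rw [pow_succ', Module.End.mul_apply, ih, map_smul, hv1x, smul_smul, pow_succ]
  have hζp : ζ ^ p = 1 := by
    have h1 := hpow p
    rw [hxp] at h1
    have h' : (ζ ^ p - 1) • v1 = 0 := by rw [sub_smul, ← h1, one_smul, sub_self]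
    rcases smul_eq_zero.1 h' with h | h
    · exact sub_eq_zero.1 h
    · exact absurd h hv10
  have hζ1 : ζ ≠ 1 := by
    rintro rfl
    have h1 : ∀ k : ℕ, (ρ x ^ k) w = w + (k : ℂ) • v1 := by
      intro k
      induction k with
      | zero => simp
      | succ k ih =>
        rw [pow_succ', Module.End.mul_apply, ih, map_add, map_smul, hv1x, hw', one_smul]
        push_cast
        rw [add_smul, one_smul]; abel
    have h2 := h1 p
    rw [hxp] at h2
    have h3 : (p : ℂ) • v1 = 0 := by simpa using h2.symm
    rcases smul_eq_zero.1 h3 with h | h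
    · exact hp0 h
    · exact hv10 h
  have hζ0 : ζ ≠ 0 := by
    rintro rfl
    rw [zero_pow hpp.out.ne_zero] at hζp
    exact zero_ne_one hζp
  have hζζ : ζ ≠ ζ⁻¹ := by
    intro h
    have h2 : ζ ^ 2 = 1 := by rw [pow_two]; nth_rw 2 [h]; exact mul_inv_cancel₀ hζ0
    have h3 := pow_gcd_eq_one.2 ⟨h2, hζp⟩
    rw [((Nat.coprime_primes Nat.prime_two hpp.out).2 hp.symm).gcd_eq_one, pow_one] at h3
    exact hζ1 h3
  have hv1i : ρ x⁻¹ v1 = ζ⁻¹ • v1 := by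
    have := congrArg (ρ x⁻¹) hv1x
    rw [rho_inv, map_smul] at this
    have h2 := congrArg (ζ⁻¹ • ·) this
    simp only [smul_smul, inv_mul_cancel₀ hζ0, one_smul] at h2
    exact h2.symm
  have hv2x : ρ x (ρ s v1) = ζ⁻¹ • ρ s v1 := by
    rw [rho_conj, hs', hv1i, map_smul]
  have hv20 : ρ s v1 ≠ 0 := fun h => hv10 (rho_injective ρ s (by simpa using h))
  let μ : Fin 3 → ℂ := ![1, ζ, ζ⁻¹]
  let v : Fin 3 → V := ![v0, v1, ρ s v1]
  have hμ : Function.Injective μ := by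
    have a1 : (1 : ℂ) ≠ ζ⁻¹ := fun h => hζ1 (by rw [← inv_inv ζ, ← h, inv_one])
    intro i j
    fin_cases i <;> fin_cases j <;> simp [μ, hζ1, hζ1.symm, hζζ, hζζ.symm, a1, a1.symm]
  have hμv : ∀ i, ρ x (v i) = μ i • v i := by
    intro i
    fin_cases i
    · simpa [v, μ] using hv0x
    · simpa [v, μ] using hv1x
    · simpa [v, μ] using hv2x
  have hv : ∀ i, v i ≠ 0 := by
    intro i
    fin_cases i
    · exact hv0
    · exact hv10
    · exact hv20
  have hli : LinearIndependent ℂ v :=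
    Module.End.eigenvectors_linearIndependent' (ρ x) μ hμ v (fun i =>
      Module.End.hasEigenvector_iff.2 ⟨Module.End.mem_eigenspace_iff.2 (hμv i), hv i⟩)
  refine ⟨basisOfLinearIndependentOfCardEqFinrank hli (by simp [hd]), μ, hμ, rfl, fun i => ?_⟩
  rw [coe_basisOfLinearIndependentOfCardEqFinrank]
  exact hμv i

theorem eig_mem {T : Module.End ℂ V} (b : Module.Basis (Fin 3) ℂ V) {μ : Fin 3 → ℂ}
    (hμ : Function.Injective μ) (h : ∀ i, T (b i) = μ i • b i) {i : Fin 3} {w : V}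
    (hw : T w = μ i • w) : ∃ a : ℂ, w = a • b i := by
  have h1 : ∀ j, b.repr (T w) j = μ j * b.repr w j := by
    intro j
    conv_lhs => rw [← b.sum_repr w]
    simp only [map_sum, map_smul, h, Finsupp.coe_finsetSum, Finset.sum_apply, Finsupp.smul_apply,
      Module.Basis.repr_self, smul_eq_mul]
    rw [Finset.sum_eq_single j]
    · simp; ring
    · intro k _ hk; simp [hk]
    · simp
  refine ⟨b.repr w i, ?_⟩
  conv_lhs => rw [← b.sum_repr w]
  rw [Finset.sum_eq_single i]
  · intro j _ hj
    have h2 := h1 j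
    rw [hw, map_smul, Finsupp.smul_apply, smul_eq_mul] at h2
    have h3 : (μ j - μ i) * b.repr w j = 0 := by linear_combination -h2
    rcases mul_eq_zero.1 h3 with h4 | h4
    · exact absurd (hμ (sub_eq_zero.1 h4)) hj
    · rw [h4, zero_smul]
  · simp

theorem exists_prime_pow [Finite G] {u : G} (ho : Odd (orderOf u)) (h1 : u ≠ 1) :
    ∃ (p : ℕ) (_ : Fact p.Prime) (k : ℕ), p ≠ 2 ∧ orderOf (u ^ k) = p := by
  have h : orderOf u ≠ 1 := fun h => h1 (orderOf_eq_one_iff.1 h)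
  obtain ⟨p, hp, hd⟩ := Nat.exists_prime_and_dvd h
  refine ⟨p, ⟨hp⟩, orderOf u / p, ?_, ?_⟩
  · rintro rfl
    exact (Nat.not_odd_iff_even.2 (even_iff_two_dvd.2 hd)) ho
  · rw [orderOf_pow_of_dvd _ (Nat.div_dvd_of_dvd hd), Nat.div_div_self hd (orderOf_pos u).ne']
    exact Nat.ne_of_gt (Nat.div_pos (Nat.le_of_dvd (orderOf_pos u) hd) hp.pos)

/-- a nontrivial power of `u` has a nice eigenbasis -/
theorem D3u [Finite G] {ρ : G →* Module.End ℂ V} (c : Ctx ρ) {u : G} (ho : Odd (orderOf u))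
    (h1 : u ≠ 1) : ∃ k : ℕ, u ^ k ≠ 1 ∧
    ∃ (b : Module.Basis (Fin 3) ℂ V) (μ : Fin 3 → ℂ), Function.Injective μ ∧ μ 0 = 1 ∧
      ∀ i, ρ (u ^ k) (b i) = μ i • b i := by
  obtain ⟨p, _, k, hp, hk⟩ := exists_prime_pow ho h1
  refine ⟨k, fun h => ?_, D3 c hp hk⟩
  rw [h, orderOf_one] at hk
  exact (Fact.out : p.Prime).one_lt.ne hk

theorem cent_comm [Finite G] {ρ : G →* Module.End ℂ V} (c : Ctx ρ) {u : G} (ho : Odd (orderOf u))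
    (h1 : u ≠ 1) {y z : G} (hy : y * u = u * y) (hz : z * u = u * z) : y * z = z * y := by
  obtain ⟨k, -, b, μ, hμ, -, h⟩ := D3u c ho h1
  have key : ∀ y, y * u = u * y → ∀ i, ∃ a : ℂ, ρ y (b i) = a • b i := by
    intro y hy i
    apply eig_mem b hμ h
    have : u ^ k * y = y * u ^ k := ((show Commute y u from hy).pow_right k).eq.symm
    rw [← rho_mul, this, rho_mul, h, map_smul]
  apply c.inj
  apply b.ext
  intro i
  obtain ⟨a, ha⟩ := key y hy i
  obtain ⟨a', ha'⟩ := key z hz i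
  rw [rho_mul, rho_mul, ha, ha', map_smul, map_smul, ha, ha', smul_comm]

theorem card_even [Finite G] {ρ : G →* Module.End ℂ V} (c : Ctx ρ) : ¬ Odd (Nat.card G) := by
  intro ho
  have := c.nontriv
  refine mm (fun H hH x hx y hy => ?_) c.perf
  have := odd_abelian _ H rfl (ho.of_dvd_nat H.card_subgroup_dvd_card) (c.e2 _ hH) ⟨x, hx⟩ ⟨y, hy⟩
  exact congrArg Subtype.val this

theorem D4 [Finite G] {ρ : G →* Module.End ℂ V} (c : Ctx ρ) [Fact (Nat.Prime 2)] (S : Sylow 2 G) :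
    ∃ a ∈ S, ∃ b ∈ S, a * b ≠ b * a := by
  by_contra hc
  push Not at hc
  have hN : Subgroup.normalizer (S : Set G) ≤ Subgroup.centralizer (S : Set G) := by
    intro n hn x hx
    have h2 := D1sq c S hc (fun x hx => (hn x).1 hx) x hx
    obtain ⟨e, r, hr, he⟩ := Nat.exists_eq_two_pow_mul_odd (orderOf_pos n).ne'
    have hor : orderOf (n ^ r) = 2 ^ e := by
      rw [orderOf_pow_of_dvd, he, Nat.mul_div_cancel _ hr.pos]
      · exact hr.pos.ne'
      · exact ⟨2 ^ e, by rw [he, mul_comm]⟩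
    have hmem : n ^ r ∈ (S : Subgroup G) := by
      have h3 := (isPGroup_zpowers hor).inf_normalizer_sylow S
      have h4 : n ^ r ∈ Subgroup.zpowers (n ^ r) ⊓ Subgroup.normalizer (S : Set G) :=
        ⟨Subgroup.mem_zpowers _, pow_mem hn r⟩
      rw [h3] at h4
      exact h4.2
    have h5 : Commute (n ^ r) x := hc _ hmem x hx
    have h6 : Commute (n * n) x := h2
    obtain ⟨k, rfl⟩ := hr
    have h7 : n = n ^ (2 * k + 1) * ((n * n) ^ k)⁻¹ := by
      rw [← pow_two, ← pow_mul, pow_succ']; simp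
    have h8 : Commute n x := by
      rw [h7]; exact h5.mul_left ((h6.pow_left k).inv_left)
    exact h8.eq.symm
  have hb := sylow_bot_of_normalizer_le c.perf S hN
  have h := S.not_dvd_index
  rw [hb, Subgroup.index_bot] at h
  apply card_even c
  rw [← Nat.not_even_iff_odd, even_iff_two_dvd]
  exact h

end


/-- involutions which are central in some Sylow 2-subgroup -/
def Ctr {G : Type*} [Group G] (t : G) : Prop :=
  t ≠ 1 ∧ t * t = 1 ∧ ∃ S : Sylow 2 G, t ∈ S ∧ ∀ s ∈ S, t * s = s * t

theorem four_aux {M : Type*} [Group M] {σ : M →* M2} (hσ : Function.Injective σ) {a b y : M}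
    (ha2 : a * a = 1) (hb2 : b * b = 1) (hy2 : y * y = 1) (hab : a * b = b * a)
    (hay : a * y = y * a) (hb1 : b ≠ 1) (hba : b ≠ a) (hs : ¬ IsSc (σ a))
    (hy1 : y ≠ 1) (hya : y ≠ a) (hyb : y ≠ b) : y = a * b := by
  have ea : σ a * σ a = 1 := by rw [← map_mul, ha2, map_one]
  have hb := invol_comm (Y := σ b) hs ea (by rw [← map_mul, hab, map_mul])
    (by rw [← map_mul, hb2, map_one])
  have hy := invol_comm (Y := σ y) hs ea (by rw [← map_mul, hay, map_mul])
    (by rw [← map_mul, hy2, map_one])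
  have b1 : σ b ≠ 1 := fun h => hb1 (hσ (h.trans (map_one σ).symm))
  have y1 : σ y ≠ 1 := fun h => hy1 (hσ (h.trans (map_one σ).symm))
  have b2 : σ b ≠ σ a := fun h => hba (hσ h)
  have y2 : σ y ≠ σ a := fun h => hya (hσ h)
  have yb : σ y ≠ σ b := fun h => hyb (hσ h)
  apply hσ
  rw [map_mul]
  rcases hb with h | h | h | h
  · exact absurd h b1
  · rcases hy with h' | h' | h' | h'
    · exact absurd h' y1
    · exact absurd (h'.trans h.symm) yb
    · exact absurd h' y2
    · rw [h, h']; simp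
  · exact absurd h b2
  · rcases hy with h' | h' | h' | h'
    · exact absurd h' y1
    · rw [h, h']; simp [ea]
    · exact absurd h' y2
    · exact absurd (h'.trans h.symm) yb

theorem four_group {M : Type*} [Group M] (h2 : E2 M) {a b y : M}
    (ha2 : a * a = 1) (hb2 : b * b = 1) (hy2 : y * y = 1) (hab : a * b = b * a)
    (hay : a * y = y * a) (hby : b * y = y * b) (ha1 : a ≠ 1) (hb1 : b ≠ 1) (hba : b ≠ a)
    (hy1 : y ≠ 1) (hya : y ≠ a) (hyb : y ≠ b) : y = a * b := by
  obtain ⟨σ, hσ⟩ := h2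
  by_cases hs : IsSc (σ a)
  · by_cases hs' : IsSc (σ b)
    · have ea := sq_one_scalar hs (by rw [← map_mul, ha2, map_one])
      have eb := sq_one_scalar hs' (by rw [← map_mul, hb2, map_one])
      have a1 : σ a ≠ 1 := fun h => ha1 (hσ (h.trans (map_one σ).symm))
      have b1 : σ b ≠ 1 := fun h => hb1 (hσ (h.trans (map_one σ).symm))
      exact absurd (hσ ((eb.resolve_left b1).trans (ea.resolve_left a1).symm)) hba
    · rw [hab]
      exact four_aux hσ hb2 ha2 hy2 hab.symm hby ha1 hba.symm hs' hy1 hyb hya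
  · exact four_aux hσ ha2 hb2 hy2 hab hay hb1 hba hs hy1 hya hyb

theorem central_unique {M : Type*} [Group M] (h2 : E2 M) (hne : ∃ a b : M, a * b ≠ b * a) {s t : M}
    (hs : ∀ g, s * g = g * s) (ht : ∀ g, t * g = g * t) (hs2 : s * s = 1) (ht2 : t * t = 1)
    (hs1 : s ≠ 1) (ht1 : t ≠ 1) : s = t := by
  obtain ⟨σ, hσ⟩ := h2
  obtain ⟨a, b, hab⟩ := hne
  have key : ∀ s, (∀ g, s * g = g * s) → s * s = 1 → s ≠ 1 → σ s = -1 := by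
    intro s hs hs2 hs1
    rcases sq_one_scalar (E2.scalar hσ hab (hs a) (hs b)) (by rw [← map_mul, hs2, map_one]) with h | h
    · exact absurd (hσ (h.trans (map_one σ).symm)) hs1
    · exact h
  exact hσ ((key s hs hs2 hs1).trans (key t ht ht2 ht1).symm)

section
variable {G V : Type*} [Group G] [AddCommGroup V] [Module ℂ V]

open scoped Pointwise in
theorem mem_smul_sylow {S : Sylow 2 G} {g x : G} : x ∈ g • S ↔ g⁻¹ * x * g ∈ S := by
  change x ∈ MulAut.conj g • (S : Subgroup G) ↔ _
  rw [Subgroup.mem_pointwise_smul_iff_inv_smul_mem]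
  simp only [MulAut.smul_def, ← map_inv, MulAut.conj_apply, inv_inv]
  exact Iff.rfl

theorem Ctr.conj {t : G} (h : Ctr t) (g : G) : Ctr (g * t * g⁻¹) := by
  obtain ⟨h1, h2, S, hS, hc⟩ := h
  refine ⟨fun e => h1 ?_, ?_, g • S, mem_smul_sylow.2 ?_, fun s hs => ?_⟩
  · have : t = g⁻¹ * (g * t * g⁻¹) * g := by group
    rw [this, e]; group
  · have : g * t * g⁻¹ * (g * t * g⁻¹) = g * (t * t) * g⁻¹ := by group
    rw [this, h2]; group
  · have : g⁻¹ * (g * t * g⁻¹) * g = t := by group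
    rwa [this]
  · have := hc _ (mem_smul_sylow.1 hs)
    calc g * t * g⁻¹ * s = g * (t * (g⁻¹ * s * g)) * g⁻¹ := by group
      _ = g * ((g⁻¹ * s * g) * t) * g⁻¹ := by rw [this]
      _ = s * (g * t * g⁻¹) := by group

theorem sylow_central_unique [Finite G] {ρ : G →* Module.End ℂ V} (c : Ctx ρ) (S : Sylow 2 G) {t t' : G}
    (ht : t ∈ S) (ht' : t' ∈ S) (hc : ∀ s ∈ S, t * s = s * t) (hc' : ∀ s ∈ S, t' * s = s * t')
    (h2 : t * t = 1) (h2' : t' * t' = 1) (h1 : t ≠ 1) (h1' : t' ≠ 1) : t = t' := by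
  obtain ⟨a, ha, b, hb, hab⟩ := D4 c S
  have := central_unique (M := S) (c.e2 _ (c.pgroup_ne_top S.isPGroup'))
    ⟨⟨a, ha⟩, ⟨b, hb⟩, fun e => hab (congrArg Subtype.val e)⟩ (s := ⟨t, ht⟩) (t := ⟨t', ht'⟩)
    (fun g => Subtype.ext (hc g g.2)) (fun g => Subtype.ext (hc' g g.2))
    (Subtype.ext h2) (Subtype.ext h2') (fun e => h1 (congrArg Subtype.val e))
    (fun e => h1' (congrArg Subtype.val e))
  exact congrArg Subtype.val this

theorem Ctr.isConj [Finite G] {ρ : G →* Module.End ℂ V} (c : Ctx ρ) {t t' : G} (h : Ctr t) (h' : Ctr t') :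
    ∃ g, t' = g * t * g⁻¹ := by
  obtain ⟨h1', h2', S', hS', hc'⟩ := h'
  obtain ⟨h1, h2, S, hS, hc⟩ := h
  obtain ⟨g, rfl⟩ := MulAction.exists_smul_eq G S S'
  have hk := Ctr.conj ⟨h1, h2, S, hS, hc⟩ g
  refine ⟨g, sylow_central_unique c (g • S) hS' (mem_smul_sylow.2 ?_) hc' ?_ h2' hk.2.1 h1' hk.1⟩
  · have : g⁻¹ * (g * t * g⁻¹) * g = t := by group
    rwa [this]
  · intro s hs
    have := hc _ (mem_smul_sylow.1 hs)
    calc g * t * g⁻¹ * s = g * (t * (g⁻¹ * s * g)) * g⁻¹ := by group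
      _ = g * ((g⁻¹ * s * g) * t) * g⁻¹ := by rw [this]
      _ = s * (g * t * g⁻¹) := by group

theorem exists_ctr [Finite G] {ρ : G →* Module.End ℂ V} (c : Ctx ρ) (S : Sylow 2 G) :
    ∃ z, z ≠ 1 ∧ z * z = 1 ∧ z ∈ S ∧ ∀ s ∈ S, z * s = s * z := by
  obtain ⟨a, ha, b, hb, hab⟩ := D4 c S
  have : Nontrivial S := ⟨⟨a, ha⟩, 1, fun e => hab (by
    have : a = 1 := congrArg Subtype.val e
    rw [this]; simp)⟩
  have hnt : Nontrivial (Subgroup.center S) := S.isPGroup'.center_nontrivial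
  have hpz : IsPGroup 2 (Subgroup.center S) := S.isPGroup'.to_subgroup _
  have hdvd : 2 ∣ Nat.card (Subgroup.center S) := by
    obtain ⟨n, hn0, hn⟩ := hpz.nontrivial_iff_card.mp hnt
    exact hn.symm ▸ dvd_pow_self _ (ne_of_gt hn0)
  obtain ⟨z, hz⟩ := exists_prime_orderOf_dvd_card' 2 hdvd
  have hz2 : z * z = 1 := by
    have := pow_orderOf_eq_one z
    rwa [hz, pow_two] at this
  refine ⟨z, ?_, ?_, z.1.2, fun s hs => ?_⟩
  · intro e
    have : z = 1 := Subtype.ext (Subtype.ext e)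
    rw [this, orderOf_one] at hz
    omega
  · exact congrArg (fun w : Subgroup.center S => ((w : S) : G)) hz2
  · exact (congrArg Subtype.val ((Subgroup.mem_center_iff.1 z.2) ⟨s, hs⟩)).symm

theorem D5a [Finite G] {t : G} (h : Ctr t) (Q : Subgroup G) (hQ : IsPGroup 2 Q)
    (hQt : ∀ q ∈ Q, t * q = q * t) :
    ∃ S : Sylow 2 G, Q ≤ S ∧ t ∈ S ∧ ∀ s ∈ S, t * s = s * t := by
  obtain ⟨h1, h2, S, hS, hc⟩ := h
  let H := Subgroup.centralizer ({t} : Set G)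
  have memH : ∀ x, x ∈ H ↔ t * x = x * t := fun x => by
    simp [H, Subgroup.mem_centralizer_iff]
  have hSH : (S : Subgroup G) ≤ H := fun s hs => (memH s).2 (hc s hs)
  have hQH : Q ≤ H := fun q hq => (memH q).2 (hQt q hq)
  have hQ' : IsPGroup 2 (Q.subgroupOf H) := hQ.comap_of_injective H.subtype H.subtype_injective
  obtain ⟨R, hR⟩ := hQ'.exists_le_sylow
  obtain ⟨h, hh⟩ := MulAction.exists_smul_eq H (S.subtype hSH) R
  refine ⟨(h : G) • S, fun q hq => ?_, ?_, fun s hs => ?_⟩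
  · have : (⟨q, hQH hq⟩ : H) ∈ R := hR hq
    rw [← hh, mem_smul_sylow] at this
    exact mem_smul_sylow.2 this
  · rw [mem_smul_sylow, mul_assoc, (memH h).1 h.2]; simpa using hS
  · have e := hc _ (mem_smul_sylow.1 hs)
    have e2 := (memH h).1 h.2
    have e3 : (h : G)⁻¹ * t = t * (h : G)⁻¹ := ((show Commute t h from e2).inv_right).eq.symm
    calc t * s = t * h * ((h : G)⁻¹ * s * h) * (h : G)⁻¹ := by group
      _ = h * (t * ((h : G)⁻¹ * s * h)) * (h : G)⁻¹ := by rw [e2]; group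
      _ = h * ((h : G)⁻¹ * s * h) * (t * (h : G)⁻¹) := by rw [e]; group
      _ = s * t := by rw [← e3]; group

theorem Ctr.not_central {ρ : G →* Module.End ℂ V} (c : Ctx ρ) {t : G} (h1 : t ≠ 1) (h2 : t * t = 1) :
    ∃ g, t * g ≠ g * t := by
  by_contra hc
  push Not at hc
  exact h1 (central_invol c.inj c.dim c.irr hc h2 (by rw [c.perf]; trivial))

theorem order2 {t : G} (h1 : t ≠ 1) (h2 : t * t = 1) : orderOf t = 2 ^ 1 := by
  rw [pow_one]; exact orderOf_eq_prime (by rw [pow_two, h2]) h1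

theorem inv_of_sq {t : G} (h : t * t = 1) : t⁻¹ = t := inv_eq_of_mul_eq_one_right h

theorem D6half [Finite G] {ρ : G →* Module.End ℂ V} (c : Ctx ρ) {t t' : G} (h : Ctr t) (h' : Ctr t')
    (hcomm : t * t' = t' * t) (hne : t ≠ t') :
    ∃ n, n * t * n⁻¹ = t ∧ n * t' * n⁻¹ = t * t' := by
  obtain ⟨ht1, ht2, -⟩ := id h
  obtain ⟨ht1', ht2', -⟩ := id h'
  let B := Subgroup.centralizer ({t, t'} : Set G)
  have memB : ∀ x, x ∈ B ↔ t * x = x * t ∧ t' * x = x * t' := fun x => by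
    simp [B, Subgroup.mem_centralizer_iff]
  have hBtop : B ≠ ⊤ := by
    intro e
    obtain ⟨g, hg⟩ := Ctr.not_central c ht1 ht2
    have : g ∈ B := by rw [e]; trivial
    exact hg ((memB g).1 this).1
  have htB : t ∈ B := (memB t).2 ⟨rfl, hcomm.symm⟩
  have htB' : t' ∈ B := (memB t').2 ⟨hcomm, rfl⟩
  have hE : IsPGroup 2 (Subgroup.zpowers (⟨t, htB⟩ : B) ⊔ Subgroup.zpowers (⟨t', htB'⟩ : B) : Subgroup B) := by
    apply IsPGroup.to_sup_of_normal_right'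
    · exact isPGroup_zpowers (k := 1) (order2 (fun e => ht1 (congrArg Subtype.val e)) (Subtype.ext ht2))
    · exact isPGroup_zpowers (k := 1) (order2 (fun e => ht1' (congrArg Subtype.val e)) (Subtype.ext ht2'))
    · rw [Subgroup.zpowers_le]
      apply Subgroup.mem_normalizer_fintype
      rintro _ ⟨k, rfl⟩
      have : Commute (⟨t, htB⟩ : B) (⟨t', htB'⟩ : B) := Subtype.ext hcomm
      have := (this.zpow_right k).eq
      simp only at this ⊢
      rw [this]; simp
  obtain ⟨R, hR⟩ := hE.exists_le_sylow
  let Q := (R : Subgroup B).map B.subtype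
  have hQB : Q ≤ B := by rintro _ ⟨x, _, rfl⟩; exact x.2
  have memQ : ∀ x : G, x ∈ Q ↔ ∃ hx : x ∈ B, (⟨x, hx⟩ : B) ∈ R := by
    intro x
    constructor
    · rintro ⟨y, hy, rfl⟩; exact ⟨y.2, hy⟩
    · rintro ⟨hx, h⟩; exact ⟨⟨x, hx⟩, h, rfl⟩
  have hQp : IsPGroup 2 Q := R.isPGroup'.map _
  have htQ : t ∈ Q := (memQ t).2 ⟨htB, hR (Subgroup.mem_sup_left (Subgroup.mem_zpowers _))⟩
  have htQ' : t' ∈ Q := (memQ t').2 ⟨htB', hR (Subgroup.mem_sup_right (Subgroup.mem_zpowers _))⟩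
  obtain ⟨S, hQS, htS, hSc⟩ := D5a h Q hQp (fun q hq => ((memB q).1 (hQB hq)).1)
  have hlt : Q.subgroupOf S < ⊤ := by
    rw [lt_top_iff_ne_top]
    intro e
    have hSQ : (S : Subgroup G) ≤ Q := Subgroup.subgroupOf_eq_top.1 e
    exact hne (sylow_central_unique c S htS (hQS htQ') hSc
      (fun s hs => ((memB s).1 (hQB (hSQ hs))).2) ht2 ht2' ht1 ht1')
  have : Group.IsNilpotent S := S.isPGroup'.isNilpotent
  obtain ⟨n, hn, hnQ⟩ := SetLike.exists_of_lt (Group.normalizerCondition_of_isNilpotent _ hlt)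
  have hnQ' : (n : G) ∉ Q := fun h => hnQ h
  have hnn : ∀ x ∈ Q, (n : G) * x * (n : G)⁻¹ ∈ Q := fun x hx =>
    (hn ⟨x, hQS hx⟩).1 hx
  have hnB : (n : G) ∉ B := by
    intro hnB
    apply hnQ'
    rw [memQ]
    refine ⟨hnB, ?_⟩
    obtain ⟨k, hk⟩ := S.isPGroup'.exists_orderOf_eq_pow n
    have hp : IsPGroup 2 (Subgroup.zpowers (⟨n, hnB⟩ : B)) := isPGroup_zpowers (k := k) (by
      rw [← hk, Subgroup.orderOf_mk, Subgroup.orderOf_coe])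
    have h4 : (⟨n, hnB⟩ : B) ∈ Subgroup.zpowers (⟨n, hnB⟩ : B) ⊓ Subgroup.normalizer (R : Set B) := by
      refine ⟨Subgroup.mem_zpowers _, Subgroup.mem_normalizer_fintype fun x hx => ?_⟩
      have := hnn x ⟨x, hx, rfl⟩
      obtain ⟨hx', h''⟩ := (memQ _).1 this
      exact h''
    rw [hp.inf_normalizer_sylow R] at h4
    exact h4.2
  have hnt : (n : G) * t * (n : G)⁻¹ = t := by rw [← hSc n n.2]; group
  refine ⟨n, hnt, ?_⟩
  have hyQ := hnn t' htQ'
  have hyB := hQB hyQ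
  have e := four_group (c.e2 B hBtop) (a := ⟨t, htB⟩) (b := ⟨t', htB'⟩) (y := ⟨_, hyB⟩)
    (Subtype.ext ht2) (Subtype.ext ht2') (Subtype.ext (by
      change (n : G) * t' * (n : G)⁻¹ * ((n : G) * t' * (n : G)⁻¹) = 1
      have : (n : G) * t' * (n : G)⁻¹ * ((n : G) * t' * (n : G)⁻¹) = n * (t' * t') * (n : G)⁻¹ := by group
      rw [this, ht2']; group)) (Subtype.ext hcomm)
    (Subtype.ext ((memB _).1 hyB).1) (Subtype.ext ((memB _).1 hyB).2)
    (fun e => ht1 (congrArg Subtype.val e)) (fun e => ht1' (congrArg Subtype.val e))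
    (fun e => hne (congrArg Subtype.val e).symm)
    (fun e => ht1' (conj_eq_one_iff.1 (congrArg Subtype.val e)))
    (fun e => hne (by
      have e' : (n : G) * t' * (n : G)⁻¹ = t := congrArg Subtype.val e
      rw [← hnt] at e'
      exact (mul_left_cancel (mul_right_cancel e')).symm))
    (fun e => hnB ((memB _).2 ⟨hSc n n.2, by
      have e' : (n : G) * t' * (n : G)⁻¹ = t' := congrArg Subtype.val e
      exact (mul_inv_eq_iff_eq_mul.1 e').symm⟩))
  exact congrArg Subtype.val e

theorem D6 [Finite G] {ρ : G →* Module.End ℂ V} (c : Ctx ρ) {t t' : G} (h : Ctr t) (h' : Ctr t')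
    (hcomm : t * t' = t' * t) : t = t' := by
  by_contra hne
  obtain ⟨n, hn1, hn2⟩ := D6half c h h' hcomm hne
  obtain ⟨n', hn1', hn2'⟩ := D6half c h' h hcomm.symm (Ne.symm hne)
  obtain ⟨ht1, ht2, -⟩ := id h
  obtain ⟨ht1', ht2', -⟩ := id h'
  set k := n * n' with hk
  have k1 : k * t * k⁻¹ = t' := by
    calc k * t * k⁻¹ = n * (n' * t * n'⁻¹) * n⁻¹ := by rw [hk]; group
      _ = (n * t' * n⁻¹) * (n * t * n⁻¹) := by rw [hn2']; group
      _ = t * t' * t := by rw [hn1, hn2]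
      _ = t' := by rw [hcomm, mul_assoc, ht2, mul_one]
  have k2 : k * t' * k⁻¹ = t * t' := by
    calc k * t' * k⁻¹ = n * (n' * t' * n'⁻¹) * n⁻¹ := by rw [hk]; group
      _ = t * t' := by rw [hn1', hn2]
  let E := Subgroup.closure ({t, t'} : Set G)
  have htE : t ∈ E := Subgroup.subset_closure (by simp)
  have htE' : t' ∈ E := Subgroup.subset_closure (by simp)
  have hEc : ∀ x ∈ E, ∀ y ∈ E, x * y = y * x := by
    intro x hx y hy
    have hc : ∀ x ∈ ({t, t'} : Set G), ∀ y ∈ ({t, t'} : Set G), x * y = y * x := by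
      rintro x (rfl | rfl) y (rfl | rfl)
      · rfl
      · exact hcomm
      · exact hcomm.symm
      · rfl
    have h1 : E ≤ Subgroup.centralizer ({t, t'} : Set G) := (Subgroup.closure_le _).2
      (fun x hx y hy => hc y hy x hx)
    have h2 : E ≤ Subgroup.centralizer (E : Set G) := (Subgroup.closure_le _).2
      (fun x hx y hy => (h1 hy x hx).symm)
    exact (h2 hx y hy).symm
  have hEn : ∀ x ∈ E, k * x * k⁻¹ ∈ E := by
    have : E ≤ E.comap (MulAut.conj k).toMonoidHom := (Subgroup.closure_le _).2 (by
      rintro x (rfl | rfl)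
      · change k * x * k⁻¹ ∈ E
        rw [k1]; exact htE'
      · change k * x * k⁻¹ ∈ E
        rw [k2]; exact mul_mem htE htE')
    exact fun x hx => this hx
  have h3 := D1sq c E hEc hEn t htE
  have h4 : k * k * t = t * t' * (k * k) := by
    calc k * k * t = (k * (k * t * k⁻¹) * k⁻¹) * (k * k) := by group
      _ = t * t' * (k * k) := by rw [k1, k2]
  rw [h4] at h3
  have h5 := mul_right_cancel h3
  exact ht1' (by simpa using h5)

theorem D7a [Finite G] {ρ : G →* Module.End ℂ V} (c : Ctx ρ) {t t' : G} (h : Ctr t) (h' : Ctr t')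
    (Q : Subgroup G) (hQ : IsPGroup 2 Q) (ht : t ∈ Q) (ht' : t' ∈ Q) : t = t' := by
  obtain ⟨S, hS⟩ := hQ.exists_le_sylow
  obtain ⟨z, z1, z2, zS, hz⟩ := exists_ctr c S
  have hzc : Ctr z := ⟨z1, z2, S, zS, hz⟩
  exact (D6 c hzc h (hz t (hS ht))).symm.trans (D6 c hzc h' (hz t' (hS ht')))

theorem D7 [Finite G] {ρ : G →* Module.End ℂ V} (c : Ctx ρ) {t t' : G} (h : Ctr t) (h' : Ctr t') :
    Odd (orderOf (t * t')) := by
  obtain ⟨ht1, ht2, -⟩ := id h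
  obtain ⟨ht1', ht2', -⟩ := id h'
  set u := t * t' with hu
  obtain ⟨e, r, hr, he⟩ := Nat.exists_eq_two_pow_mul_odd (orderOf_pos u).ne'
  have hor : orderOf (u ^ r) = 2 ^ e := by
    rw [orderOf_pow_of_dvd, he, Nat.mul_div_cancel _ hr.pos]
    · exact hr.pos.ne'
    · exact ⟨2 ^ e, by rw [he, mul_comm]⟩
  have hinv : t * u * t⁻¹ = u⁻¹ := by
    rw [hu, mul_inv_rev, inv_of_sq ht2, inv_of_sq ht2', ← mul_assoc, ht2, one_mul]
  have hinvk : ∀ k : ℕ, t * u ^ k * t⁻¹ = (u ^ k)⁻¹ := by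
    intro k
    rw [← conj_pow, hinv, inv_pow]
  have hC : Ctr (u ^ r * t) := by
    obtain ⟨k, rfl⟩ := hr
    have h1 := (h'.conj t).conj (u ^ k)
    have e1 : t * t' * t⁻¹ = u * t := by rw [hu, inv_of_sq ht2]
    have e2 : t * (u ^ k)⁻¹ = u ^ k * t := by
      have h3 := hinvk k
      rw [mul_inv_eq_iff_eq_mul] at h3
      have : Commute (u ^ k)⁻¹ (u^k) := (Commute.refl _).inv_left
      calc t * (u ^ k)⁻¹ = u ^ k * ((u ^ k)⁻¹ * t) * (u ^ k)⁻¹ := by group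
        _ = u ^ k * t := by rw [← h3]; group
    have e3 : u ^ k * (t * t' * t⁻¹) * (u ^ k)⁻¹ = u ^ (2 * k + 1) * t := by
      rw [e1, mul_assoc, mul_assoc, e2, ← mul_assoc, ← mul_assoc, ← pow_succ, ← pow_add]
      congr 2
      omega
    rwa [e3] at h1
  have hp : IsPGroup 2 (Subgroup.zpowers t ⊔ Subgroup.zpowers (u ^ r) : Subgroup G) := by
    apply IsPGroup.to_sup_of_normal_right' (isPGroup_zpowers (order2 ht1 ht2)) (isPGroup_zpowers hor)
    rw [Subgroup.zpowers_le]
    apply Subgroup.mem_normalizer_fintype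
    rintro _ ⟨k, rfl⟩
    change t * (u ^ r) ^ k * t⁻¹ ∈ Subgroup.zpowers (u ^ r)
    rw [← conj_zpow, hinvk]
    exact zpow_mem (inv_mem (Subgroup.mem_zpowers _)) k
  have h1 := D7a c h hC _ hp (Subgroup.mem_sup_left (Subgroup.mem_zpowers t))
    (mul_mem (Subgroup.mem_sup_right (Subgroup.mem_zpowers _))
      (Subgroup.mem_sup_left (Subgroup.mem_zpowers t)))
  have h2 : u ^ r = 1 := by simpa using h1.symm
  rw [h2, orderOf_one] at hor
  rw [he, ← hor, one_mul]
  exact hr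

end


/-- odd order and nontrivial -/
def Od {G : Type*} [Group G] (u : G) : Prop := Odd (orderOf u) ∧ u ≠ 1

open Classical in
/-- elements of odd order commuting with `u` -/
noncomputable def Of {G : Type*} [Group G] [Fintype G] (u : G) : Finset G :=
  Finset.univ.filter fun v => Odd (orderOf v) ∧ v * u = u * v

theorem orderOf_conj' {G : Type*} [Group G] (g x : G) : orderOf (g * x * g⁻¹) = orderOf x :=
  orderOf_injective (MulAut.conj g).toMonoidHom (MulAut.conj g).injective x

theorem Od.conj {G : Type*} [Group G] {u : G} (h : Od u) (g : G) : Od (g * u * g⁻¹) :=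
  ⟨by rw [orderOf_conj']; exact h.1, fun e => h.2 (conj_eq_one_iff.1 e)⟩

section
variable {G V : Type*} [Group G] [Fintype G] [AddCommGroup V] [Module ℂ V]

theorem mem_Of {u v : G} : v ∈ Of u ↔ Odd (orderOf v) ∧ v * u = u * v := by
  classical
  simp [Of]

theorem odd_mul {x y : G} (h : x * y = y * x) (hx : Odd (orderOf x)) (hy : Odd (orderOf y)) :
    Odd (orderOf (x * y)) :=
  (hx.mul hy).of_dvd_nat ((show Commute x y from h).orderOf_mul_dvd_mul_orderOf)

theorem comm_trans {ρ : G →* Module.End ℂ V} (c : Ctx ρ) {u : G} (hu : Od u) {y z : G}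
    (hy : y * u = u * y) (hz : z * u = u * z) : y * z = z * y := cent_comm c hu.1 hu.2 hy hz

theorem Of_eq {ρ : G →* Module.End ℂ V} (c : Ctx ρ) {u v : G} (hu : Od u) (hv : Od v)
    (h : v * u = u * v) : Of v = Of u := by
  ext y
  rw [mem_Of, mem_Of]
  refine and_congr_right fun _ => ⟨fun hy => ?_, fun hy => ?_⟩
  · exact comm_trans c hv hy h.symm
  · exact comm_trans c hu hy h

/-- the subgroup version -/
theorem Of_subgroup {ρ : G →* Module.End ℂ V} (c : Ctx ρ) {u : G} (hu : Od u) :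
    ∃ K : Subgroup G, ∀ x, x ∈ K ↔ x ∈ Of u := by
  refine ⟨{ carrier := {x | x ∈ Of u}, mul_mem' := ?_, one_mem' := ?_, inv_mem' := ?_ },
    fun x => Iff.rfl⟩
  · intro a b ha hb
    simp only [Set.mem_setOf_eq, mem_Of] at ha hb ⊢
    refine ⟨odd_mul (comm_trans c hu ha.2 hb.2) ha.1 hb.1, ?_⟩
    exact ((show Commute a u from ha.2).mul_left (show Commute b u from hb.2)).eq
  · simp [mem_Of]
  · intro a ha
    simp only [Set.mem_setOf_eq, mem_Of] at ha ⊢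
    exact ⟨by rw [orderOf_inv]; exact ha.1, ((show Commute a u from ha.2).inv_left).eq⟩

theorem card_Of {u : G} {K : Subgroup G} (hK : ∀ x, x ∈ K ↔ x ∈ Of u) :
    Nat.card K = (Of u).card := by
  rw [← Nat.card_eq_finsetCard]
  exact Nat.card_congr (Equiv.subtypeEquivRight hK)

theorem self_mem_Of {u : G} (hu : Od u) : u ∈ Of u := mem_Of.2 ⟨hu.1, rfl⟩

theorem one_mem_Of {u : G} : (1 : G) ∈ Of u := mem_Of.2 ⟨by simp, by simp⟩

theorem Of_odd {ρ : G →* Module.End ℂ V} (c : Ctx ρ) {u : G} (hu : Od u) : Odd (Of u).card := by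
  obtain ⟨K, hK⟩ := Of_subgroup c hu
  rw [← card_Of hK, ← Nat.not_even_iff_odd, even_iff_two_dvd]
  intro h
  obtain ⟨z, hz⟩ := exists_prime_orderOf_dvd_card' 2 h
  have := (mem_Of.1 ((hK z).1 z.2)).1
  rw [Subgroup.orderOf_coe, hz] at this
  exact absurd this (by decide)

theorem Of_three {ρ : G →* Module.End ℂ V} (c : Ctx ρ) {u : G} (hu : Od u) : 3 ≤ (Of u).card := by
  have h1 := Of_odd c hu
  have h2 : 1 < (Of u).card := Finset.one_lt_card.2 ⟨u, self_mem_Of hu, 1, one_mem_Of, hu.2⟩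
  obtain ⟨k, hk⟩ := h1
  omega

theorem Of_conj_card {u : G} (g : G) : (Of (g * u * g⁻¹)).card = (Of u).card := by
  symm
  apply Finset.card_bij (fun x _ => g * x * g⁻¹)
  · intro a ha
    rw [mem_Of] at ha ⊢
    refine ⟨by rw [orderOf_conj']; exact ha.1, ?_⟩
    calc g * a * g⁻¹ * (g * u * g⁻¹) = g * (a * u) * g⁻¹ := by group
      _ = g * (u * a) * g⁻¹ := by rw [ha.2]
      _ = _ := by group
  · intro a _ b _ h
    exact mul_left_cancel (mul_right_cancel h)
  · intro b hb
    rw [mem_Of] at hb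
    refine ⟨g⁻¹ * b * g, ?_, by group⟩
    rw [mem_Of]
    constructor
    · have := orderOf_conj' g⁻¹ b
      rw [inv_inv] at this
      rw [this]; exact hb.1
    · calc g⁻¹ * b * g * u = g⁻¹ * (b * (g * u * g⁻¹)) * g := by group
        _ = g⁻¹ * ((g * u * g⁻¹) * b) * g := by rw [hb.2]
        _ = _ := by group

theorem hall {ρ : G →* Module.End ℂ V} (c : Ctx ρ) {u : G} (hu : Od u) {p k : ℕ} (hp : p.Prime)
    (hpO : p ∣ (Of u).card) (hk : p ^ k ∣ Nat.card G) : p ^ k ∣ (Of u).card := by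
  have : Fact p.Prime := ⟨hp⟩
  have hp2 : p ≠ 2 := by
    rintro rfl
    exact Nat.not_odd_iff_even.2 (even_iff_two_dvd.2 hpO) (Of_odd c hu)
  obtain ⟨K, hK⟩ := Of_subgroup c hu
  rw [← card_Of hK] at hpO ⊢
  obtain ⟨x, hx⟩ := exists_prime_orderOf_dvd_card' p hpO
  have hx' : orderOf (x : G) = p := by rw [Subgroup.orderOf_coe, hx]
  have hxd : Od (x : G) := ⟨by rw [hx']; exact hp.odd_of_ne_two hp2, fun e => by
    rw [e, orderOf_one] at hx'; exact hp.one_lt.ne hx'⟩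
  obtain ⟨P, hP⟩ := (isPGroup_zpowers (k := 1) (by rw [hx', pow_one])).exists_le_sylow
  have hxP : (x : G) ∈ (P : Subgroup G) := hP (Subgroup.mem_zpowers _)
  have hPK : (P : Subgroup G) ≤ K := by
    intro y hy
    rw [hK, ← Of_eq c hu hxd (mem_Of.1 ((hK x).1 x.2)).2, mem_Of]
    refine ⟨?_, c.pgroup_comm hp2 P.isPGroup' y hy x hxP⟩
    have := odd_orderOf (sylow_odd hp2 P.isPGroup') ⟨y, hy⟩
    rwa [Subgroup.orderOf_mk] at this
  exact (P.pow_dvd_card_of_pow_dvd_card hk).trans (Subgroup.card_dvd_of_le hPK)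

theorem normA {ρ : G →* Module.End ℂ V} (c : Ctx ρ) {u n : G} (hu : Od u)
    (hn : (n * u * n⁻¹) * u = u * (n * u * n⁻¹)) {x : G} (hx : x * u = u * x) :
    (n * x * n⁻¹) * u = u * (n * x * n⁻¹) := by
  apply comm_trans c (hu.conj n) _ hn.symm
  calc n * x * n⁻¹ * (n * u * n⁻¹) = n * (x * u) * n⁻¹ := by group
    _ = n * (u * x) * n⁻¹ := by rw [hx]
    _ = _ := by group

theorem INV {ρ : G →* Module.End ℂ V} (c : Ctx ρ) {u n v : G} (hu : Od u)
    (hn : (n * u * n⁻¹) * u = u * (n * u * n⁻¹)) (hnu : n * u ≠ u * n) (hv : v ∈ Of u) :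
    n * v * n⁻¹ = v⁻¹ := by
  rw [mem_Of] at hv
  let A := Subgroup.centralizer ({u} : Set G)
  have memA : ∀ x, x ∈ A ↔ x * u = u * x := fun x => by
    simp only [A, Subgroup.mem_centralizer_iff, Set.mem_singleton_iff, forall_eq]
    exact eq_comm
  have hAc : ∀ x ∈ A, ∀ y ∈ A, x * y = y * x := fun x hx y hy =>
    comm_trans c hu ((memA x).1 hx) ((memA y).1 hy)
  have hnA : ∀ x ∈ A, n * x * n⁻¹ ∈ A := fun x hx => (memA _).2 (normA c hu hn ((memA x).1 hx))
  have hvA : v ∈ A := (memA v).2 hv.2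
  have hsq := D1sq c A hAc hnA v hvA
  have hcv := hAc _ hvA _ (hnA v hvA)
  by_contra hne
  have hw : Od (v * (n * v * n⁻¹)) :=
    ⟨odd_mul hcv hv.1 (by rw [orderOf_conj']; exact hv.1), fun e => hne (inv_eq_of_mul_eq_one_right e).symm⟩
  apply hnu
  apply comm_trans c hw
  · have e : n * (v * (n * v * n⁻¹)) * n⁻¹ = v * (n * v * n⁻¹) := by
      calc n * (v * (n * v * n⁻¹)) * n⁻¹ = (n * v * n⁻¹) * ((n * n * v) * (n * n)⁻¹) := by group
        _ = (n * v * n⁻¹) * v := by rw [hsq]; group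
        _ = _ := hcv.symm
    exact mul_inv_eq_iff_eq_mul.1 e
  · exact (hAc _ (mul_mem hvA (hnA v hvA)) u ((memA u).2 rfl)).symm

theorem inverts {ρ : G →* Module.End ℂ V} (c : Ctx ρ) {u t v : G} (hu : Od u)
    (ht : t * u * t⁻¹ = u⁻¹) (hv : v ∈ Of u) : t * v * t⁻¹ = v⁻¹ := by
  apply INV c hu _ _ hv
  · rw [ht]; simp
  · intro e
    rw [e] at ht
    have : u * u = 1 := by
      have : u = u⁻¹ := by simpa using ht
      nth_rw 2 [this]; simp
    exact hu.2 (eq_one_of_sq_odd this hu.1)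

end


open Classical in
/-- odd order elements inverted by `t` -/
noncomputable def Jf {G : Type*} [Group G] [Fintype G] (t : G) : Finset G :=
  Finset.univ.filter fun u => Odd (orderOf u) ∧ t * u * t⁻¹ = u⁻¹

open Classical in
/-- the 2-central involutions -/
noncomputable def Xf (G : Type*) [Group G] [Fintype G] : Finset G :=
  Finset.univ.filter fun x => Ctr x

theorem invol3_matrix (A : Matrix (Fin 3) (Fin 3) ℂ) (h : A * A = 1) (hd : A.det = 1) (h1 : A ≠ 1) :
    A.trace ^ 2 = 1 := by
  have hadj : A.adjugate = A := by
    have := Matrix.adjugate_mul A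
    rw [hd, one_smul] at this
    calc A.adjugate = A.adjugate * (A * A) := by rw [h, mul_one]
      _ = _ := by rw [← mul_assoc, this, one_mul]
  have hCH : ∀ i j, A.adjugate i j = (A * A) i j - A.trace * A i j +
      (A 0 0 * A 1 1 - A 0 1 * A 1 0 + (A 0 0 * A 2 2 - A 0 2 * A 2 0) +
        (A 1 1 * A 2 2 - A 1 2 * A 2 1)) * (1 : Matrix (Fin 3) (Fin 3) ℂ) i j := by
    intro i j
    rw [Matrix.adjugate_fin_three]
    fin_cases i <;> fin_cases j <;>
      simp [Matrix.mul_apply, Fin.sum_univ_three, Matrix.trace] <;> ring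
  rw [hadj] at hCH
  rw [h] at hCH
  have htr : A.trace = A 0 0 + A 1 1 + A 2 2 := by simp [Matrix.trace, Fin.sum_univ_three]
  have h00 := congrFun (congrFun h 0) 0
  have h11 := congrFun (congrFun h 1) 1
  have h22 := congrFun (congrFun h 2) 2
  simp [Matrix.mul_apply, Fin.sum_univ_three] at h00 h11 h22
  set e := (A 0 0 * A 1 1 - A 0 1 * A 1 0 + (A 0 0 * A 2 2 - A 0 2 * A 2 0) +
        (A 1 1 * A 2 2 - A 1 2 * A 2 1)) with he
  have c0 := hCH 0 0
  have c1 := hCH 1 1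
  have c2 := hCH 2 2
  simp only [Matrix.one_apply_eq] at c0 c1 c2
  have e1 : A.trace ^ 2 - 2 * e = 3 := by
    rw [htr, he]; linear_combination h00 + h11 + h22
  have e2 : A.trace = 3 - A.trace ^ 2 + 3 * e := by
    linear_combination (1 + A.trace) * htr + c0 + c1 + c2 - A.trace * htr - htr + htr + A.trace * htr
  have e3 : e = A.trace := by linear_combination e1 - e2
  have hq : (A.trace - 3) * (A.trace + 1) = 0 := by linear_combination e1 + 2 * e3
  rcases mul_eq_zero.1 hq with h3 | h3
  · exfalso
    have h3' : A.trace = 3 := by linear_combination h3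
    apply h1
    ext i j
    have := hCH i j
    rw [e3, h3'] at this
    linear_combination this / 4
  · have : A.trace = -1 := by linear_combination h3
    rw [this]; norm_num

section
variable {G V : Type*} [Group G] [Fintype G] [AddCommGroup V] [Module ℂ V]

theorem mem_Jf {t u : G} : u ∈ Jf t ↔ Odd (orderOf u) ∧ t * u * t⁻¹ = u⁻¹ := by
  classical
  simp [Jf]

theorem mem_Xf {x : G} : x ∈ Xf G ↔ Ctr x := by
  classical
  simp [Xf]

theorem J_iff {ρ : G →* Module.End ℂ V} (c : Ctx ρ) {t u : G} (ht : Ctr t) :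
    u ∈ Jf t ↔ t * u ∈ Xf G := by
  rw [mem_Jf, mem_Xf]
  have t2 := ht.2.1
  have ti := inv_of_sq t2
  constructor
  · rintro ⟨⟨k, hk⟩, hi⟩
    have e : t * u = (u ^ (k + 1))⁻¹ * t * ((u ^ (k + 1))⁻¹)⁻¹ := by
      have e1 : t * u ^ (k + 1) * t⁻¹ = (u ^ (k + 1))⁻¹ := by
        rw [← conj_pow, hi, inv_pow]
      have e2 : u ^ (k + 1) * u ^ (k + 1) = u := by
        rw [← pow_add, show k + 1 + (k + 1) = orderOf u + 1 by omega, pow_succ, pow_orderOf_eq_one,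
          one_mul]
      rw [inv_inv, ← e1]
      calc t * u = t * (u ^ (k + 1) * u ^ (k + 1)) := by rw [e2]
        _ = _ := by simp only [mul_assoc, inv_mul_cancel_left, inv_mul_cancel, mul_one]
    rw [e]
    exact ht.conj _
  · intro h
    have h7 := D7 c ht h
    rw [← mul_assoc, t2, one_mul] at h7
    refine ⟨h7, ?_⟩
    have h2 := h.2.1
    rw [ti]
    exact eq_inv_of_mul_eq_one_left (by simpa [mul_assoc] using h2)

theorem J_sum {ρ : G →* Module.End ℂ V} (c : Ctx ρ) {t : G} (ht : Ctr t) {M : Type*} [AddCommMonoid M]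
    (F : G → M) : ∑ u ∈ Jf t, F u = ∑ x ∈ Xf G, F (t * x) := by
  have t2 := ht.2.1
  have e : ∀ x, t * (t * x) = x := fun x => by rw [← mul_assoc, t2, one_mul]
  refine Finset.sum_nbij' (fun u => t * u) (fun x => t * x) ?_ ?_ ?_ ?_ ?_
  · intro u hu; exact (J_iff c ht).1 hu
  · intro x hx; exact (J_iff c ht).2 (by rw [e]; exact hx)
  · intro u _; exact e u
  · intro u _; exact e u
  · intro u _; simp only [e]

theorem J_card {ρ : G →* Module.End ℂ V} (c : Ctx ρ) {t : G} (ht : Ctr t) :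
    (Jf t).card = (Xf G).card := by
  have := J_sum c ht (fun _ => (1 : ℕ))
  simpa using this

theorem X_dvd {ρ : G →* Module.End ℂ V} (c : Ctx ρ) {t : G} (ht : Ctr t) :
    (Xf G).card ∣ Nat.card G := by
  have h : (MulAction.orbit (ConjAct G) t) = (Xf G : Set G) := by
    ext x
    rw [Finset.mem_coe, mem_Xf, ConjAct.mem_orbit_conjAct]
    constructor
    · intro h
      obtain ⟨g, hg⟩ := isConj_iff.1 h.symm
      rw [← hg]; exact ht.conj g
    · intro h
      obtain ⟨g, hg⟩ := Ctr.isConj c ht h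
      exact (isConj_iff.2 ⟨g, hg.symm⟩ : IsConj t x).symm
  have h2 := MulAction.index_stabilizer (ConjAct G) t
  rw [h, Set.ncard_coe_finset] at h2
  rw [← h2]
  exact Subgroup.index_dvd_card _

noncomputable def tr (ρ : G →* Module.End ℂ V) (g : G) : ℂ := LinearMap.trace ℂ V (ρ g)

theorem tr_conj (ρ : G →* Module.End ℂ V) (g x : G) : tr ρ (g * x * g⁻¹) = tr ρ x := by
  unfold tr
  rw [map_mul, LinearMap.trace_mul_comm, ← map_mul]
  congr 2
  group

theorem Ctx.fin {ρ : G →* Module.End ℂ V} (c : Ctx ρ) : Module.Finite ℂ V :=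
  Module.finite_of_finrank_pos (by rw [c.dim]; norm_num)

theorem tr_t {ρ : G →* Module.End ℂ V} (c : Ctx ρ) {t : G} (ht : Ctr t) : tr ρ t ^ 2 = 1 := by
  have := c.fin
  let b : Module.Basis (Fin 3) ℂ V := Module.finBasisOfFinrankEq ℂ V c.dim
  unfold tr
  rw [LinearMap.trace_eq_matrix_trace ℂ b]
  apply invol3_matrix
  · rw [← LinearMap.toMatrix_mul, ← map_mul, ht.2.1, map_one, LinearMap.toMatrix_one]
  · rw [LinearMap.det_toMatrix]
    have := map_eq_one_of_mem_commutator ((LinearMap.det : Module.End ℂ V →* ℂ).comp ρ)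
      (x := t) (by rw [c.perf]; trivial)
    exact this
  · intro e
    apply ht.1
    apply c.inj
    rw [map_one]
    apply (LinearMap.toMatrix b b).injective
    rw [e, LinearMap.toMatrix_one]

theorem J_trace {ρ : G →* Module.End ℂ V} (c : Ctx ρ) {t : G} (ht : Ctr t) :
    3 * ∑ u ∈ Jf t, tr ρ u = ((Jf t).card : ℂ) := by
  have := c.fin
  obtain ⟨k, hk⟩ := schur c.dim c.irr (∑ x ∈ Xf G, ρ x) (by
    intro g v
    simp only [LinearMap.sum_apply, map_sum]
    refine Finset.sum_nbij' (fun x => g⁻¹ * x * g) (fun x => g * x * g⁻¹) ?_ ?_ ?_ ?_ ?_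
    · intro x hx
      rw [mem_Xf] at hx ⊢
      have := hx.conj g⁻¹
      rwa [inv_inv] at this
    · intro x hx
      rw [mem_Xf] at hx ⊢
      exact hx.conj g
    · intro x _; group
    · intro x _; group
    · intro x _; exact rho_conj ρ g x v)
  have hT : (∑ x ∈ Xf G, ρ x) = k • (1 : Module.End ℂ V) := LinearMap.ext fun v => by
    rw [hk]; simp
  have h1 : ∑ x ∈ Xf G, tr ρ x = k * 3 := by
    unfold tr
    rw [← map_sum, hT, map_smul, LinearMap.trace_one, c.dim]; simp
  have h2 : ∑ x ∈ Xf G, tr ρ x = (Xf G).card * tr ρ t := by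
    rw [Finset.sum_congr rfl (g := fun _ => tr ρ t), Finset.sum_const, nsmul_eq_mul]
    intro x hx
    obtain ⟨g, rfl⟩ := Ctr.isConj c ht (mem_Xf.1 hx)
    exact tr_conj ρ g t
  rw [J_sum c ht (fun u => tr ρ u)]
  have h3 : ∑ x ∈ Xf G, tr ρ (t * x) = k * tr ρ t := by
    unfold tr
    simp only [map_mul]
    rw [← map_sum, ← Finset.mul_sum, hT, mul_smul_comm, mul_one, map_smul]; simp
  rw [h3, J_card c ht]
  have := tr_t c ht
  linear_combination -(tr ρ t) * h1 + tr ρ t * h2 + ((Xf G).card : ℂ) * this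

theorem O_trace {ρ : G →* Module.End ℂ V} (c : Ctx ρ) {t u : G} (ht : t * t = 1) (hu : Od u)
    (htu : t * u * t⁻¹ = u⁻¹) : ∑ v ∈ Of u, tr ρ v = ((Of u).card : ℂ) := by
  have := c.fin
  obtain ⟨k, hk1, b, μ, hμ, hμ0, hb⟩ := D3u c hu.1 hu.2
  obtain ⟨K, hK⟩ := Of_subgroup c hu
  have hxK : u ^ k ∈ K := pow_mem ((hK u).2 (self_mem_Of hu)) k
  set x := u ^ k with hx
  have hxO : x ∈ Of u := (hK x).1 hxK
  have hcx : ∀ v ∈ Of u, v * x = x * v := fun v hv =>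
    comm_trans c hu (mem_Of.1 hv).2 (mem_Of.1 hxO).2
  set M : Module.End ℂ V := ∑ v ∈ Of u, ρ v with hM
  have hMx : ∀ w, M (ρ x w) = M w := by
    intro w
    rw [hM]
    simp only [LinearMap.sum_apply]
    refine Finset.sum_nbij' (fun v => v * x) (fun v => v * x⁻¹) ?_ ?_ ?_ ?_ ?_
    · intro v hv; exact (hK _).1 (mul_mem ((hK _).2 hv) hxK)
    · intro v hv; exact (hK _).1 (mul_mem ((hK _).2 hv) (inv_mem hxK))
    · intro v _; group
    · intro v _; group
    · intro v _; rw [rho_mul]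
  have hM0 : ∀ i, i ≠ 0 → M (b i) = 0 := by
    intro i hi
    have h1 := hMx (b i)
    rw [hb, map_smul] at h1
    have h2 : (μ i - 1) • M (b i) = 0 := by rw [sub_smul, h1, one_smul, sub_self]
    rcases smul_eq_zero.1 h2 with h | h
    · exact absurd (hμ (by rw [hμ0]; linear_combination h : μ i = μ 0)) hi
    · exact h
  have hb0 : ρ x (b 0) = b 0 := by rw [hb, hμ0, one_smul]
  have hti := inv_of_sq ht
  have hv0 : ∀ v ∈ Of u, ρ v (b 0) = b 0 := by
    intro v hv
    have hxi := inverts c hu htu hxO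
    have hvi := inverts c hu htu hv
    obtain ⟨ε, hε⟩ := eig_mem b hμ hb (i := 0) (w := ρ t (b 0)) (by
      rw [hμ0, one_smul, rho_conj ρ t x]
      congr 1
      have : t⁻¹ * x * t = x⁻¹ := by rw [← hxi, hti]
      rw [this]
      conv_lhs => rw [← hb0]
      exact rho_inv ρ x (b 0))
    obtain ⟨a, ha⟩ := eig_mem b hμ hb (i := 0) (w := ρ v (b 0)) (by
      rw [hμ0, one_smul, ← rho_mul, ← hcx v hv, rho_mul, hb0])
    have hne : b 0 ≠ 0 := b.ne_zero 0
    have h1 : ρ v⁻¹ (b 0) = a • b 0 := by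
      rw [← hvi, hti, rho_mul, rho_mul, hε, map_smul, map_smul, ha, map_smul, hε, smul_comm a ε,
        smul_smul, smul_smul]
      have : ε * ε = 1 := by
        have h3 : ρ t (ρ t (b 0)) = b 0 := by rw [← rho_mul, ht, map_one]; rfl
        rw [hε, map_smul, hε, smul_smul] at h3
        have h4 : (ε * ε - 1) • b 0 = 0 := by rw [sub_smul, h3, one_smul, sub_self]
        rcases smul_eq_zero.1 h4 with h | h
        · linear_combination h
        · exact absurd h hne
      rw [this, one_mul]
    have h2 : a * a = 1 := by
      have h3 : ρ v (ρ v⁻¹ (b 0)) = b 0 := by rw [← rho_mul, mul_inv_cancel, map_one]; rfl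
      rw [h1, map_smul, ha, smul_smul] at h3
      have h4 : (a * a - 1) • b 0 = 0 := by rw [sub_smul, h3, one_smul, sub_self]
      rcases smul_eq_zero.1 h4 with h | h
      · linear_combination h
      · exact absurd h hne
    have h5 : ∀ n : ℕ, ρ (v ^ n) (b 0) = a ^ n • b 0 := by
      intro n
      induction n with
      | zero => simp
      | succ n ih => rw [pow_succ, rho_mul, ha, map_smul, ih, smul_smul, pow_succ, mul_comm]
    have h6 := h5 (orderOf v)
    rw [pow_orderOf_eq_one, map_one] at h6
    have h7 : a ^ orderOf v = 1 := by
      have h4 : (a ^ orderOf v - 1) • b 0 = 0 := by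
        rw [sub_smul, ← h6, one_smul]; exact sub_self _
      rcases smul_eq_zero.1 h4 with h | h
      · linear_combination h
      · exact absurd h hne
    obtain ⟨j, hj⟩ := (mem_Of.1 hv).1
    rw [hj, pow_succ, pow_mul, pow_two, h2, one_pow, one_mul] at h7
    rw [ha, h7, one_smul]
  have hMb0 : M (b 0) = ((Of u).card : ℂ) • b 0 := by
    rw [hM]
    simp only [LinearMap.sum_apply]
    rw [Finset.sum_congr rfl hv0, Finset.sum_const, Nat.cast_smul_eq_nsmul]
  have : ∑ v ∈ Of u, tr ρ v = LinearMap.trace ℂ V M := by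
    unfold tr
    rw [hM, map_sum]
  rw [this, LinearMap.trace_eq_matrix_trace ℂ b, Matrix.trace, Fin.sum_univ_three]
  simp only [Matrix.diag_apply, LinearMap.toMatrix_apply]
  rw [hM0 1 (by decide), hM0 2 (by decide), hMb0]
  simp
end


open Classical in
/-- the blocks of the partition of `J \ {1}` -/
noncomputable def Bf {G : Type*} [Group G] [Fintype G] (t : G) : Finset (Finset G) :=
  ((Jf t).erase 1).image Of

open Classical in
/-- the centralizer as a finset -/
noncomputable def Cf {G : Type*} [Group G] [Fintype G] (u : G) : Finset G :=
  Finset.univ.filter fun v => v * u = u * v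

open Classical in
/-- elements with a nontrivial power in a conjugate of `Of u` -/
noncomputable def Tf {G : Type*} [Group G] [Fintype G] (u : G) : Finset G :=
  Finset.univ.filter fun g => ∃ (x : G) (k : ℕ), g ^ k ≠ 1 ∧ g ^ k ∈ Of (x * u * x⁻¹)

section
variable {G V : Type*} [Group G] [Fintype G] [AddCommGroup V] [Module ℂ V]

theorem mem_Bf {t : G} {O : Finset G} : O ∈ Bf t ↔ ∃ u, Od u ∧ t * u * t⁻¹ = u⁻¹ ∧ Of u = O := by
  classical
  simp only [Bf, Finset.mem_image, Finset.mem_erase, mem_Jf, Od]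
  constructor
  · rintro ⟨u, ⟨h1, h2, h3⟩, h4⟩; exact ⟨u, ⟨h2, h1⟩, h3, h4⟩
  · rintro ⟨u, ⟨h1, h2⟩, h3, h4⟩; exact ⟨u, ⟨h2, h1, h3⟩, h4⟩

theorem mem_Cf {u v : G} : v ∈ Cf u ↔ v * u = u * v := by
  classical
  simp [Cf]

theorem mem_Tf {u g : G} : g ∈ Tf u ↔ ∃ (x : G) (k : ℕ), g ^ k ≠ 1 ∧ g ^ k ∈ Of (x * u * x⁻¹) := by
  classical
  simp [Tf]

theorem Jsum_part {ρ : G →* Module.End ℂ V} (c : Ctx ρ) {t : G} {M : Type*} [AddCommGroup M]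
    (F : G → M) : ∑ u ∈ Jf t, F u = F 1 + ∑ O ∈ Bf t, (∑ u ∈ O, F u - F 1) := by
  classical
  have h1 : (1 : G) ∈ Jf t := mem_Jf.2 ⟨by simp, by simp⟩
  rw [← Finset.add_sum_erase _ _ h1]
  congr 1
  have hmap : ∀ u ∈ (Jf t).erase 1, Of u ∈ Bf t := fun u hu => by
    unfold Bf
    exact Finset.mem_image_of_mem _ hu
  rw [← Finset.sum_fiberwise_of_maps_to hmap]
  refine Finset.sum_congr rfl fun O hO => ?_
  obtain ⟨u, hu, htu, rfl⟩ := mem_Bf.1 hO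
  rw [← Finset.add_sum_erase (Of u) F one_mem_Of, add_sub_cancel_left]
  refine Finset.sum_congr ?_ fun _ _ => rfl
  ext v
  rw [Finset.mem_filter, Finset.mem_erase, Finset.mem_erase, mem_Jf]
  constructor
  · rintro ⟨⟨h1, h2, h3⟩, h4⟩
    exact ⟨h1, by rw [← h4]; exact self_mem_Of ⟨h2, h1⟩⟩
  · rintro ⟨h1, h2⟩
    have h3 := mem_Of.1 h2
    exact ⟨⟨h1, h3.1, inverts c hu htu h2⟩, Of_eq c hu ⟨h3.1, h1⟩ h3.2⟩

theorem J_count {ρ : G →* Module.End ℂ V} (c : Ctx ρ) {t : G} :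
    ((Jf t).card : ℤ) = 1 + ∑ O ∈ Bf t, ((O.card : ℤ) - 1) := by
  have := Jsum_part c (t := t) (fun _ => (1 : ℤ))
  simpa using this

theorem J_count3 {ρ : G →* Module.End ℂ V} (c : Ctx ρ) {t : G} (ht : Ctr t) :
    3 * (Bf t).card = (Jf t).card + 3 := by
  have := c.fin
  have h1 := J_trace c ht
  rw [Jsum_part c (fun u => tr ρ u)] at h1
  have h2 : tr ρ 1 = 3 := by
    unfold tr
    rw [map_one, LinearMap.trace_one, c.dim]; norm_num
  have h3 : ∑ O ∈ Bf t, (∑ u ∈ O, tr ρ u - tr ρ 1) = ∑ O ∈ Bf t, (((O.card : ℂ) - 1) - 2) := by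
    refine Finset.sum_congr rfl fun O hO => ?_
    obtain ⟨u, hu, htu, rfl⟩ := mem_Bf.1 hO
    rw [O_trace c ht.2.1 hu htu, h2]; ring
  rw [h3, Finset.sum_sub_distrib, Finset.sum_const, nsmul_eq_mul, h2] at h1
  have h4 : ((Jf t).card : ℂ) = 1 + ∑ O ∈ Bf t, ((O.card : ℂ) - 1) := by
    exact_mod_cast congrArg (fun n : ℤ => (n : ℂ)) (J_count c (t := t))
  have h5 : (3 * (Bf t).card : ℂ) = (Jf t).card + 3 := by
    linear_combination -h1 / 2 - 3 / 2 * h4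
  exact_mod_cast h5

theorem T_one {u : G} : (1 : G) ∉ Tf u := by
  rw [mem_Tf]; rintro ⟨x, k, h, -⟩; simp at h

theorem T_disj {ρ : G →* Module.End ℂ V} (c : Ctx ρ) {u u' : G} (hu : Od u) (hu' : Od u')
    (hne : (Of u).card ≠ (Of u').card) : Disjoint (Tf u) (Tf u') := by
  rw [Finset.disjoint_left]
  intro g h h'
  obtain ⟨x, k, h1, h2⟩ := mem_Tf.1 h
  obtain ⟨x', k', h1', h2'⟩ := mem_Tf.1 h'
  have m := mem_Of.1 h2
  have m' := mem_Of.1 h2'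
  have e := Of_eq c (hu.conj x) ⟨m.1, h1⟩ m.2
  have e' := Of_eq c (hu'.conj x') ⟨m'.1, h1'⟩ m'.2
  have e'' := Of_eq c ⟨m.1, h1⟩ ⟨m'.1, h1'⟩ (by rw [← pow_add, ← pow_add, add_comm])
  apply hne
  rw [← Of_conj_card x, ← Of_conj_card (u := u') x', ← e, ← e', e'']

theorem two_part {u s : G} (hs : s * u = u * s) (h : ∀ k, s ^ k ∈ Of u → s ^ k = 1) :
    ∃ e, orderOf s = 2 ^ e := by
  obtain ⟨e, r, hr, he⟩ := Nat.exists_eq_two_pow_mul_odd (orderOf_pos s).ne'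
  have hor : orderOf (s ^ (2 ^ e)) = r := by
    rw [orderOf_pow_of_dvd (by positivity) (by rw [he]; exact dvd_mul_right _ _), he,
      Nat.mul_div_cancel_left _ (by positivity)]
  have := h (2 ^ e) (mem_Of.2 ⟨by rw [hor]; exact hr, ((show Commute s u from hs).pow_left _).eq⟩)
  rw [this, orderOf_one] at hor
  exact ⟨e, by rw [he, ← hor, mul_one]⟩

theorem N_card {ρ : G →* Module.End ℂ V} (c : Ctx ρ) {u : G} (hu : Od u) (N : Finset G)
    (hN : ∀ n ∈ N, (n * u * n⁻¹) * u = u * (n * u * n⁻¹)) : N.card ≤ 2 * (Cf u).card := by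
  classical
  have h1 : (N.filter (· ∈ Cf u)).card ≤ (Cf u).card :=
    Finset.card_le_card fun x hx => (Finset.mem_filter.1 hx).2
  have h2 : (N.filter (fun x => ¬ x ∈ Cf u)).card ≤ (Cf u).card := by
    rcases (N.filter (fun x => ¬ x ∈ Cf u)).eq_empty_or_nonempty with h | ⟨n0, hn0⟩
    · rw [h]; simp
    · have key : ∀ n ∈ N.filter (fun x => ¬ x ∈ Cf u), n * u * n⁻¹ = u⁻¹ := by
        intro n hn
        rw [Finset.mem_filter, mem_Cf] at hn
        exact INV c hu (hN n hn.1) hn.2 (self_mem_Of hu)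
      apply Finset.card_le_card_of_injOn (fun n => n0 * n)
      · intro n hn
        rw [Finset.mem_coe, mem_Cf]
        apply mul_inv_eq_iff_eq_mul.1
        calc n0 * n * u * (n0 * n)⁻¹ = n0 * (n * u * n⁻¹) * n0⁻¹ := by group
          _ = (n0 * u * n0⁻¹)⁻¹ := by rw [key n hn]; group
          _ = u := by rw [key n0 hn0, inv_inv]
      · intro a _ b _ h; exact mul_left_cancel h
  have := Finset.card_filter_add_card_filter_not (s := N) (· ∈ Cf u)
  omega

theorem T_card {ρ : G →* Module.End ℂ V} (c : Ctx ρ) {u : G} (hu : Od u) :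
    Fintype.card G ≤ 3 * (Tf u).card := by
  classical
  let Y : Finset G := (Cf u).filter fun y => ∃ k : ℕ, y ^ k ≠ 1 ∧ y ^ k ∈ Of u
  let Z : Finset G := (Cf u).filter fun y => ¬ ∃ k : ℕ, y ^ k ≠ 1 ∧ y ^ k ∈ Of u
  have hYZ : Y.card + Z.card = (Cf u).card := Finset.card_filter_add_card_filter_not _
  have memY : ∀ y, y ∈ Y ↔ y * u = u * y ∧ ∃ k : ℕ, y ^ k ≠ 1 ∧ y ^ k ∈ Of u := fun y => by
    simp only [Y, Finset.mem_filter, mem_Cf]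
  obtain ⟨K, hK⟩ := Of_subgroup c hu
  have hZ : Z.card * (Of u).card ≤ (Cf u).card := by
    rw [← Finset.card_product]
    apply Finset.card_le_card_of_injOn (fun p => p.1 * p.2)
    · rintro ⟨s, v⟩ hp
      simp only [Finset.coe_product, Set.mem_prod, Finset.mem_coe, Z, Finset.mem_filter, mem_Cf] at hp
      rw [Finset.mem_coe, mem_Cf]
      exact ((show Commute s u from hp.1.1).mul_left (show Commute v u from (mem_Of.1 hp.2).2)).eq
    · rintro ⟨s, v⟩ hp ⟨s', v'⟩ hp' h
      simp only [Finset.coe_product, Set.mem_prod, Finset.mem_coe, Z, Finset.mem_filter, mem_Cf] at hp hp'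
      simp only at h
      obtain ⟨⟨hs, hs2⟩, hv⟩ := hp
      obtain ⟨⟨hs', hs2'⟩, hv'⟩ := hp'
      push Not at hs2 hs2'
      obtain ⟨e, he⟩ := two_part hs (fun k hk => by_contra fun hc => hs2 k hc hk)
      obtain ⟨e', he'⟩ := two_part hs' (fun k hk => by_contra fun hc => hs2' k hc hk)
      have hcss : Commute s s'⁻¹ := (show Commute s s' from comm_trans c hu hs hs').inv_right
      have e1 : s'⁻¹ * s = v' * v⁻¹ := by
        rw [eq_mul_inv_iff_mul_eq, mul_assoc, h]; group
      have o1 : Odd (orderOf (s'⁻¹ * s)) := by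
        rw [e1]
        exact (mem_Of.1 ((hK _).1 (mul_mem ((hK _).2 hv') (inv_mem ((hK _).2 hv))))).1
      have o2 : orderOf (s'⁻¹ * s) ∣ 2 ^ (e' + e) := by
        refine (hcss.symm.orderOf_mul_dvd_mul_orderOf).trans ?_
        rw [orderOf_inv, he, he', pow_add]
      have o3 : orderOf (s'⁻¹ * s) = 1 :=
        Nat.eq_one_of_dvd_coprimes ((Nat.coprime_two_right.2 o1).pow_right (e' + e)) dvd_rfl o2
      rw [orderOf_eq_one_iff] at o3
      have : s = s' := (inv_mul_eq_one.1 o3).symm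
      subst this
      rw [mul_left_cancel h]
  have h3 := Of_three c hu
  have hT : ((Finset.univ : Finset G) ×ˢ Y).card ≤ (2 * (Cf u).card) * (Tf u).card := by
    apply Finset.card_le_mul_card_image_of_maps_to (f := fun p => p.1 * p.2 * p.1⁻¹)
    · rintro ⟨g, y⟩ hp
      simp only [Finset.mem_product, memY] at hp
      obtain ⟨-, hy, k, hk1, hk2⟩ := hp
      rw [mem_Tf]
      refine ⟨g, k, ?_, ?_⟩
      · rw [conj_pow]; exact fun e => hk1 (conj_eq_one_iff.1 e)
      · rw [conj_pow, mem_Of]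
        rw [mem_Of] at hk2
        refine ⟨by rw [orderOf_conj']; exact hk2.1, ?_⟩
        calc g * y ^ k * g⁻¹ * (g * u * g⁻¹) = g * (y ^ k * u) * g⁻¹ := by group
          _ = g * (u * y ^ k) * g⁻¹ := by rw [hk2.2]
          _ = _ := by group
    · intro b _
      set Fb := ((Finset.univ : Finset G) ×ˢ Y).filter (fun p => p.1 * p.2 * p.1⁻¹ = b) with hFb
      rcases Fb.eq_empty_or_nonempty with h | ⟨⟨g0, y0⟩, hp0⟩
      · rw [h]; simp
      · have hinj : Set.InjOn (fun p : G × G => g0⁻¹ * p.1) Fb := by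
          rintro ⟨g, y⟩ hp ⟨g', y'⟩ hp' h
          simp only at h
          have : g = g' := mul_left_cancel h
          subst this
          simp only [hFb, Finset.coe_filter, Set.mem_setOf_eq] at hp hp'
          have := hp.2.trans hp'.2.symm
          rw [mul_left_cancel (mul_right_cancel this)]
        rw [← Finset.card_image_of_injOn hinj]
        apply N_card c hu
        intro n hn
        obtain ⟨⟨g, y⟩, hp, rfl⟩ := Finset.mem_image.1 hn
        simp only [hFb, Finset.mem_filter, Finset.mem_product, memY] at hp hp0
        obtain ⟨⟨-, hy, k, hk1, hk2⟩, hb⟩ := hp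
        obtain ⟨⟨-, hy0, -⟩, hb0⟩ := hp0
        simp only
        set n := g0⁻¹ * g with hn
        have hny : n * y * n⁻¹ = y0 := by
          calc n * y * n⁻¹ = g0⁻¹ * (g * y * g⁻¹) * g0 := by rw [hn]; group
            _ = y0 := by rw [hb, ← hb0]; group
        have hv : Od (y ^ k) := ⟨(mem_Of.1 hk2).1, hk1⟩
        have hw := hv.conj n
        have hw2 : n * y ^ k * n⁻¹ = y0 ^ k := by rw [← conj_pow, hny]
        apply comm_trans c hw
        · calc n * u * n⁻¹ * (n * y ^ k * n⁻¹) = n * (u * y ^ k) * n⁻¹ := by group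
            _ = n * (y ^ k * u) * n⁻¹ := by rw [(mem_Of.1 hk2).2]
            _ = _ := by group
        · rw [hw2]
          exact ((show Commute y0 u from hy0).pow_left k).eq.symm
  rw [Finset.card_product, Finset.card_univ] at hT
  have hpos : 0 < (Cf u).card := Finset.card_pos.2 ⟨u, mem_Cf.2 rfl⟩
  have hY : 2 * (Cf u).card ≤ 3 * Y.card := by nlinarith
  have : (Cf u).card * (2 * Fintype.card G) ≤ (Cf u).card * (2 * (3 * (Tf u).card)) := by nlinarith
  have := Nat.le_of_mul_le_mul_left this hpos
  omega

theorem three_sizes {ρ : G →* Module.End ℂ V} (c : Ctx ρ) {u v w : G} (hu : Od u) (hv : Od v)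
    (hw : Od w) (h1 : (Of u).card ≠ (Of v).card) (h2 : (Of u).card ≠ (Of w).card)
    (h3 : (Of v).card ≠ (Of w).card) : False := by
  classical
  have d1 := T_disj c hu hv h1
  have d2 := T_disj c hu hw h2
  have d3 := T_disj c hv hw h3
  have hc : ((Tf u ∪ Tf v) ∪ Tf w).card < Fintype.card G := by
    rw [← Finset.card_univ]
    apply Finset.card_lt_card
    rw [Finset.ssubset_univ_iff]
    intro e
    have := Finset.mem_univ (1 : G)
    rw [← e] at this
    simp [T_one] at this
  rw [Finset.card_union_of_disjoint (Finset.disjoint_union_left.2 ⟨d2, d3⟩),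
    Finset.card_union_of_disjoint d1] at hc
  have := T_card c hu
  have := T_card c hv
  have := T_card c hw
  omega
end


theorem ctx_false' {G V : Type*} [Group G] [Fintype G] [AddCommGroup V] [Module ℂ V]
    {ρ : G →* Module.End ℂ V} (c : Ctx ρ) : False := by
  classical
  have : Fact (Nat.Prime 2) := ⟨Nat.prime_two⟩
  let S : Sylow 2 G := default
  obtain ⟨t, ht1, ht2, htS, htc⟩ := exists_ctr c S
  have ht : Ctr t := ⟨ht1, ht2, S, htS, htc⟩
  have hn3 := J_count3 c ht
  have hm := J_count c (t := t)
  have hmd : (Jf t).card ∣ Nat.card G := by rw [J_card c ht]; exact X_dvd c ht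
  set m := (Jf t).card with hmdef
  set n := (Bf t).card with hndef
  have hB3 : ∀ O ∈ Bf t, 3 ≤ O.card := fun O hO => by
    obtain ⟨u, hu, -, rfl⟩ := mem_Bf.1 hO
    exact Of_three c hu
  have hBo : ∀ O ∈ Bf t, Odd O.card := fun O hO => by
    obtain ⟨u, hu, -, rfl⟩ := mem_Bf.1 hO
    exact Of_odd c hu
  have hmo : ¬ 2 ∣ m := by
    have : (2 : ℤ) ∣ ∑ O ∈ Bf t, ((O.card : ℤ) - 1) := by
      apply Finset.dvd_sum
      intro O hO
      obtain ⟨k, hk⟩ := hBo O hO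
      rw [hk]; push_cast; simp
    omega
  obtain ⟨u1, hu1, htu1, h13⟩ : ∃ u, Od u ∧ t * u * t⁻¹ = u⁻¹ ∧ (Of u).card = 3 := by
    by_contra hc
    push Not at hc
    have : ∑ O ∈ Bf t, (4 : ℤ) ≤ ∑ O ∈ Bf t, ((O.card : ℤ) - 1) := by
      apply Finset.sum_le_sum
      intro O hO
      have h3 := hB3 O hO
      obtain ⟨k, hk⟩ := hBo O hO
      obtain ⟨u, hu, htu, rfl⟩ := mem_Bf.1 hO
      have := hc u hu htu
      omega
    rw [Finset.sum_const, ← hndef, nsmul_eq_mul] at this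
    omega
  obtain ⟨u2, hu2, htu2, h25⟩ : ∃ u, Od u ∧ t * u * t⁻¹ = u⁻¹ ∧ 5 ≤ (Of u).card := by
    by_contra hc
    push Not at hc
    have : ∑ O ∈ Bf t, ((O.card : ℤ) - 1) = ∑ O ∈ Bf t, (2 : ℤ) := by
      apply Finset.sum_congr rfl
      intro O hO
      have h3 := hB3 O hO
      obtain ⟨k, hk⟩ := hBo O hO
      obtain ⟨u, hu, htu, rfl⟩ := mem_Bf.1 hO
      have := hc u hu htu
      omega
    rw [Finset.sum_const, ← hndef, nsmul_eq_mul] at this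
    have hm9 : m = 9 := by omega
    rw [hm9] at hmd
    have := hall c hu1 (p := 3) (k := 2) Nat.prime_three (by rw [h13]) hmd
    rw [h13] at this
    norm_num at this
  obtain ⟨h, hht, hhu⟩ : ∃ h, h * t = t * h ∧
      (h * u2 * h⁻¹) * u2 ≠ u2 * (h * u2 * h⁻¹) := by
    by_contra hc
    push Not at hc
    obtain ⟨a, ha, b, hb, hab⟩ := D4 c S
    have key : ∀ a ∈ S, ∃ a', a' * u2 = u2 * a' ∧ Commute t a' ∧ (a = a' ∨ a = a' * t) := by
      intro a ha
      have hat := htc a ha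
      by_cases h1 : a * u2 = u2 * a
      · exact ⟨a, h1, hat, Or.inl rfl⟩
      · refine ⟨a * t, ?_, (show Commute t a from hat).mul_right (Commute.refl t), Or.inr ?_⟩
        · have h2 := INV c hu2 (hc a hat.symm) h1 (self_mem_Of hu2)
          apply mul_inv_eq_iff_eq_mul.1
          calc a * t * u2 * (a * t)⁻¹ = a * (t * u2 * t⁻¹) * a⁻¹ := by group
            _ = (a * u2 * a⁻¹)⁻¹ := by rw [htu2]; group
            _ = u2 := by rw [h2, inv_inv]
        · rw [mul_assoc, ht2, mul_one]
    obtain ⟨a', ha1, ha2, ha3⟩ := key a ha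
    obtain ⟨b', hb1, hb2, hb3⟩ := key b hb
    have hc' : Commute a' b' := comm_trans c hu2 ha1 hb1
    apply hab
    rcases ha3 with rfl | rfl <;> rcases hb3 with rfl | rfl
    · exact hc'.eq
    · exact (hc'.mul_right ha2.symm).eq
    · exact (hc'.mul_left hb2).eq
    · exact ((hc'.mul_right ha2.symm).mul_left (hb2.mul_right (Commute.refl t))).eq
  have hO1 : Of u2 ∈ Bf t := mem_Bf.2 ⟨u2, hu2, htu2, rfl⟩
  have hO2 : Of (h * u2 * h⁻¹) ∈ Bf t := mem_Bf.2 ⟨_, hu2.conj h, by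
    calc t * (h * u2 * h⁻¹) * t⁻¹ = (t * h) * u2 * (t * h)⁻¹ := by group
      _ = (h * t) * u2 * (h * t)⁻¹ := by rw [hht]
      _ = h * (t * u2 * t⁻¹) * h⁻¹ := by group
      _ = _ := by rw [htu2]; group, rfl⟩
  have hOne : Of u2 ≠ Of (h * u2 * h⁻¹) := by
    intro e
    have := self_mem_Of (hu2.conj h)
    rw [← e] at this
    exact hhu (mem_Of.1 this).2
  have hbig : 2 * ((Of u2).card - 3 : ℤ) ≤ ∑ O ∈ Bf t, ((O.card : ℤ) - 3) := by
    have h1 : ∑ O ∈ ({Of u2, Of (h * u2 * h⁻¹)} : Finset (Finset G)), ((O.card : ℤ) - 3) ≤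
        ∑ O ∈ Bf t, ((O.card : ℤ) - 3) := by
      apply Finset.sum_le_sum_of_subset_of_nonneg
      · intro O hO
        rw [Finset.mem_insert, Finset.mem_singleton] at hO
        rcases hO with rfl | rfl
        · exact hO1
        · exact hO2
      · intro O hO _
        have := hB3 O hO
        omega
    rw [Finset.sum_pair hOne, Of_conj_card] at h1
    linarith
  have hsum : ∑ O ∈ Bf t, ((O.card : ℤ) - 1) = ∑ O ∈ Bf t, ((O.card : ℤ) - 3) + 2 * n := by
    rw [Finset.sum_sub_distrib, Finset.sum_sub_distrib, Finset.sum_const, Finset.sum_const, ← hndef,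
      nsmul_eq_mul, nsmul_eq_mul]
    ring
  have hdvd : m ∣ 3 * (Of u2).card := by
    rw [Nat.dvd_iff_prime_pow_dvd_dvd]
    intro p k hp hpk
    rcases Nat.eq_zero_or_pos k with rfl | hk
    · simp
    have hpm : p ∣ m := (dvd_pow_self p hk.ne').trans hpk
    have hp2 : p ≠ 2 := by rintro rfl; exact hmo hpm
    have : Fact p.Prime := ⟨hp⟩
    obtain ⟨x, hx⟩ := exists_prime_orderOf_dvd_card' p (hpm.trans hmd)
    have hxd : Od x := ⟨by rw [hx]; exact hp.odd_of_ne_two hp2, fun e => by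
      rw [e, orderOf_one] at hx; exact hp.one_lt.ne hx⟩
    have hpx : p ∣ (Of x).card := by
      obtain ⟨K, hK⟩ := Of_subgroup c hxd
      rw [← card_Of hK, ← hx]
      exact Subgroup.orderOf_dvd_natCard K ((hK x).2 (self_mem_Of hxd))
    have hh := hall c hxd hp hpx (hpk.trans hmd)
    by_cases e1 : (Of x).card = 3
    · rw [e1] at hh; exact hh.mul_right _
    · by_cases e2 : (Of x).card = (Of u2).card
      · rw [e2] at hh; exact hh.mul_left _
      · exact (three_sizes c hu1 hu2 hxd (by omega) (by omega) (by omega)).elim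
  have := Nat.le_of_dvd (by omega) hdvd
  omega

theorem ctx_false {G V : Type*} [Group G] [Finite G] [AddCommGroup V] [Module ℂ V]
    {ρ : G →* Module.End ℂ V} (c : Ctx ρ) : False := by
  have := Fintype.ofFinite G
  exact ctx_false' c


theorem root_pow {p : ℕ} (hp : p.Prime) {a b : ℂ} (ha : a ^ p = 1) (hb : b ^ p = 1) (h1 : b ≠ 1) :
    ∃ j : ℕ, b ^ j = a := by
  have : Fact p.Prime := ⟨hp⟩
  have ho := orderOf_eq_prime hb h1
  have hr : IsPrimitiveRoot b p := ho ▸ IsPrimitiveRoot.orderOf b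
  obtain ⟨i, -, hi⟩ := hr.eq_pow_of_pow_eq_one ha
  exact ⟨i, hi⟩

theorem sc_pow {T : M2} (h : IsSc T) (n : ℕ) : T ^ n = (T 0 0) ^ n • (1 : M2) := by
  conv_lhs => rw [h.eq_smul]
  rw [smul_pow, one_pow]

theorem smul_one_inj {a b : ℂ} (h : a • (1 : M2) = b • (1 : M2)) : a = b := by
  simpa using congrFun (congrFun h 0) 0

theorem sc_one {T : M2} (h : IsSc T) (h1 : T 0 0 = 1) : T = 1 := by
  rw [h.eq_smul, h1, one_smul]

theorem sc_root {T : M2} (h : IsSc T) {n : ℕ} (hn : T ^ n = 1) : T 0 0 ^ n = 1 := by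
  rw [sc_pow h] at hn
  exact smul_one_inj (by rw [hn, one_smul])

section
variable {G : Type*} [Group G]

/-- elements of order `p` acting by scalars -/
def Bad (σ : G →* M2) (p : ℕ) : Prop :=
  ∃ y y', IsSc (σ y) ∧ IsSc (σ y') ∧ orderOf y = p ∧ orderOf y' = p ∧ y ∉ Subgroup.zpowers y'

theorem no_bad [Finite G] (σ : G →* M2) (χ : G →* ℂ) (hj : ∀ g, σ g = 1 → χ g = 1 → g = 1)
    (hb : ∀ p : ℕ, p.Prime → ¬ Bad σ p) : E2 G := by
  classical
  let P : ℕ → Prop := fun p => ∀ z, IsSc (σ z) → z ^ p = 1 → σ z 0 0 = 1 → z = 1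
  let k : ℕ := ∏ p ∈ (Nat.card G).primeFactors.filter P, p
  let τ : G →* M2 :=
    { toFun := fun g => (χ g ^ k) • σ g
      map_one' := by simp
      map_mul' := fun a b => by
        rw [map_mul, map_mul, mul_pow, smul_mul_smul_comm] }
  refine ⟨τ, ?_⟩
  rw [injective_iff_map_eq_one]
  intro g0 hg0
  by_contra hne
  have hker : Nontrivial τ.ker := ⟨⟨g0, hg0⟩, 1, fun e => hne (congrArg Subtype.val e)⟩
  have hc1 : Nat.card τ.ker ≠ 1 := by
    rw [Ne, Nat.card_eq_one_iff_unique]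
    rintro ⟨h, -⟩
    exact not_subsingleton _ h
  obtain ⟨p, hp, hpd⟩ := Nat.exists_prime_and_dvd hc1
  have : Fact p.Prime := ⟨hp⟩
  obtain ⟨⟨g, hg⟩, hgo⟩ := exists_prime_orderOf_dvd_card' p hpd
  rw [Subgroup.orderOf_mk] at hgo
  have hg' : (χ g ^ k) • σ g = 1 := hg
  have hgp : g ^ p = 1 := by rw [← hgo]; exact pow_orderOf_eq_one g
  have hg1 : g ≠ 1 := fun e => by rw [e, orderOf_one] at hgo; exact hp.one_lt.ne hgo
  have hχp : χ g ^ p = 1 := by rw [← map_pow, hgp, map_one]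
  have hχ0 : χ g ^ k ≠ 0 := by
    intro h0
    rw [h0, zero_smul] at hg'
    exact zero_ne_one hg'
  have hs : IsSc (σ g) := by
    have : σ g = (χ g ^ k)⁻¹ • (1 : M2) := by rw [← hg', smul_smul, inv_mul_cancel₀ hχ0, one_smul]
    rw [this]; exact isSc_smul_one _
  have hl : χ g ^ k * σ g 0 0 = 1 := by
    simpa using congrFun (congrFun hg' 0) 0
  by_cases hP : P p
  · have hpk : p ∣ k := Finset.dvd_prod_of_mem (fun p => p) (Finset.mem_filter.2
      ⟨Nat.mem_primeFactors.2 ⟨hp, hgo ▸ orderOf_dvd_natCard g, Nat.card_pos.ne'⟩, hP⟩)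
    obtain ⟨r, hr⟩ := hpk
    have : χ g ^ k = 1 := by rw [hr, pow_mul, hχp, one_pow]
    rw [this, one_mul] at hl
    exact hg1 (hP g hs hgp hl)
  · have hpk : ¬ p ∣ k := by
      intro hpk
      obtain ⟨q, hq, hpq⟩ := (Prime.dvd_finsetProd_iff hp.prime _).1 hpk
      rw [Finset.mem_filter] at hq
      have := (Nat.prime_dvd_prime_iff_eq hp (Nat.prime_of_mem_primeFactors hq.1)).1 hpq
      rw [this] at hP
      exact hP hq.2
    have hP' : ∃ z, IsSc (σ z) ∧ z ^ p = 1 ∧ σ z 0 0 = 1 ∧ z ≠ 1 := by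
      by_contra hc
      apply hP
      intro z h1 h2 h3
      by_contra h4
      exact hc ⟨z, h1, h2, h3, h4⟩
    obtain ⟨z, hz1, hz2, hz3, hz4⟩ := hP'
    have hgz : g ∈ Subgroup.zpowers z := by
      by_contra hc
      exact hb p hp ⟨g, z, hs, hz1, hgo, orderOf_eq_prime hz2 hz4, hc⟩
    have hσg : σ g = 1 := by
      have hle : Subgroup.zpowers z ≤ σ.ker := by
        rw [Subgroup.zpowers_le]; exact sc_one hz1 hz3
      exact hle hgz
    rw [hσg] at hl
    have hχk : χ g ^ k = 1 := by simpa using hl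
    have hχ1 : χ g = 1 := by
      have h1 := orderOf_dvd_of_pow_eq_one hχk
      have h2 := orderOf_dvd_of_pow_eq_one hχp
      have := Nat.eq_one_of_dvd_coprimes ((Nat.Prime.coprime_iff_not_dvd hp).2 hpk) h2 h1
      exact orderOf_eq_one_iff.1 this
    exact hg1 (hj g hσg hχ1)

theorem bad_case [Finite G] (σ : G →* M2) (χ : G →* ℂ) (hj : ∀ g, σ g = 1 → χ g = 1 → g = 1)
    (he : ∀ H : Subgroup G, H ≠ ⊤ → E2 H) {p : ℕ} (hp : p.Prime) (hb : Bad σ p) :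
    ∀ x ∈ commutator G, ∀ y ∈ commutator G, x * y = y * x := by
  obtain ⟨y, y', hy, hy', hyo, hyo', hyy⟩ := hb
  have hcen : ∀ z, IsSc (σ z) → z ∈ Subgroup.center G := by
    intro z hz
    rw [Subgroup.mem_center_iff]
    intro g
    have : (g * z) * (z * g)⁻¹ = 1 := by
      have e1 : σ (g * z) = σ (z * g) := by rw [map_mul, map_mul, hz.commute]
      have e2 : χ (g * z) = χ (z * g) := by rw [map_mul, map_mul, mul_comm]
      apply hj
      · rw [map_mul, e1, ← map_mul, mul_inv_cancel, map_one]
      · rw [map_mul, e2, ← map_mul, mul_inv_cancel, map_one]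
    exact mul_inv_eq_one.1 this
  have hyc := hcen y hy
  have hyc' := hcen y' hy'
  have hsup : ∀ M : Subgroup G, (∃ a ∈ M, ∃ b ∈ M, a * b ≠ b * a) → M ⊔ Subgroup.closure {y, y'} = ⊤ := by
    rintro M ⟨a, ha, b, hb, hab⟩
    by_contra hne
    set K := M ⊔ Subgroup.closure {y, y'} with hK
    obtain ⟨s, hs⟩ := he K hne
    have haK : a ∈ K := (le_sup_left : M ≤ K) ha
    have hbK : b ∈ K := (le_sup_left : M ≤ K) hb
    have hyK : y ∈ K := (le_sup_right : _ ≤ K) (Subgroup.subset_closure (by simp))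
    have hyK' : y' ∈ K := (le_sup_right : _ ≤ K) (Subgroup.subset_closure (by simp))
    have hab' : (⟨a, haK⟩ : K) * ⟨b, hbK⟩ ≠ ⟨b, hbK⟩ * ⟨a, haK⟩ := fun e => hab (congrArg Subtype.val e)
    have s1 : IsSc (s ⟨y, hyK⟩) := E2.scalar hs hab'
      (Subtype.ext ((Subgroup.mem_center_iff.1 hyc a).symm)) (Subtype.ext ((Subgroup.mem_center_iff.1 hyc b).symm))
    have s2 : IsSc (s ⟨y', hyK'⟩) := E2.scalar hs hab'
      (Subtype.ext ((Subgroup.mem_center_iff.1 hyc' a).symm)) (Subtype.ext ((Subgroup.mem_center_iff.1 hyc' b).symm))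
    have p1 : (⟨y, hyK⟩ : K) ^ p = 1 := Subtype.ext (by
      rw [← hyo]; exact pow_orderOf_eq_one y)
    have p2 : (⟨y', hyK'⟩ : K) ^ p = 1 := Subtype.ext (by
      rw [← hyo']; exact pow_orderOf_eq_one y')
    obtain ⟨j, hjj⟩ := root_pow hp (sc_root s1 (by rw [← map_pow, p1, map_one]))
      (sc_root s2 (by rw [← map_pow, p2, map_one])) (fun e => by
        have h1 := sc_one s2 e
        have h2 : (⟨y', hyK'⟩ : K) = 1 := hs (by rw [h1, map_one])
        have h3 : y' = 1 := congrArg Subtype.val h2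
        rw [h3, orderOf_one] at hyo'
        exact hp.one_lt.ne hyo')
    apply hyy
    have : (⟨y, hyK⟩ : K) = ⟨y', hyK'⟩ ^ j := hs (by
      rw [map_pow, sc_pow s2, hjj]; exact s1.eq_smul)
    have : y = y' ^ j := congrArg Subtype.val this
    rw [this]
    exact Subgroup.npow_mem_zpowers y' j
  have hcom : ∀ M : Subgroup G, (∃ a ∈ M, ∃ b ∈ M, a * b ≠ b * a) → commutator G ≤ ⁅M, M⁆ := by
    intro M hM
    have h1 : M ⊔ Subgroup.center G = ⊤ := by
      rw [eq_top_iff, ← hsup M hM]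
      apply sup_le_sup_left
      rw [Subgroup.closure_le]
      rintro z (rfl | rfl)
      · exact hyc
      · exact hyc'
    have h2 : ∀ g : G, ∃ m ∈ M, ∃ e ∈ Subgroup.center G, m * e = g := by
      intro g
      have : g ∈ M ⊔ Subgroup.center G := by rw [h1]; trivial
      exact Subgroup.mem_sup_of_normal_right.1 this
    rw [commutator_def, Subgroup.commutator_le]
    intro g _ g' _
    obtain ⟨m, hm, e, he, rfl⟩ := h2 g
    obtain ⟨m', hm', e', he', rfl⟩ := h2 g'
    have ce : ∀ x, Commute e x := fun x => (Subgroup.mem_center_iff.1 he x).symm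
    have ce' : ∀ x, Commute e' x := fun x => (Subgroup.mem_center_iff.1 he' x).symm
    have : (m * e) * (m' * e') * (m * e)⁻¹ * (m' * e')⁻¹ = m * m' * m⁻¹ * m'⁻¹ := by
      calc m * e * (m' * e') * (m * e)⁻¹ * (m' * e')⁻¹
          = m * (e * (m' * e')) * (e⁻¹ * m⁻¹) * (m' * e')⁻¹ := by group
        _ = m * m' * (e' * m⁻¹) * e'⁻¹ * m'⁻¹ := by rw [(ce _).eq]; group
        _ = _ := by rw [(ce' _).eq]; group
    have h3 := Subgroup.commutator_mem_commutator hm hm'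
    rw [commutatorElement_def] at h3 ⊢
    rw [this]
    exact h3
  by_contra hc
  push Not at hc
  have hnt : Nontrivial (commutator G) := by
    obtain ⟨x, hx, y, hy, hxy⟩ := hc
    exact ⟨⟨x, hx⟩, 1, fun e => hxy (by
      have : x = 1 := congrArg Subtype.val e
      rw [this]; simp)⟩
  refine mm (M := commutator G) ?_ ?_
  · intro H hH x hx y hy
    by_contra hxy
    apply hH
    have h1 := hcom (H.map (commutator G).subtype) ⟨x, Subgroup.mem_map_of_mem _ hx, y,
      Subgroup.mem_map_of_mem _ hy, fun e => hxy (Subtype.ext e)⟩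
    rw [eq_top_iff]
    intro w _
    have h2 : (w : G) ∈ H.map (commutator G).subtype :=
      (h1.trans (Subgroup.commutator_le_self _)) w.2
    obtain ⟨w', hw', e⟩ := h2
    have : w' = w := Subtype.ext e
    rwa [← this]
  · have h1 := hcom (commutator G) hc
    rw [eq_top_iff]
    intro w _
    have h2 := h1 w.2
    rw [← Subgroup.map_subtype_commutator] at h2
    obtain ⟨w', hw', e⟩ := h2
    have : w' = w := Subtype.ext e
    rwa [← this]

theorem red_core [Finite G] (σ : G →* M2) (χ : G →* ℂ) (hj : ∀ g, σ g = 1 → χ g = 1 → g = 1)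
    (hn : ¬ E2 G) (he : ∀ H : Subgroup G, H ≠ ⊤ → E2 H) :
    ∀ x ∈ commutator G, ∀ y ∈ commutator G, x * y = y * x := by
  by_contra hc
  apply hn
  apply no_bad σ χ hj
  intro p hp hb
  exact hc (bad_case σ χ hj he hp hb)

theorem toM2 {U : Type*} [AddCommGroup U] [Module ℂ U] (h : Module.finrank ℂ U = 2)
    (τ : G →* Module.End ℂ U) : ∃ σ : G →* M2, ∀ g, σ g = 1 → τ g = 1 := by
  have : Module.Finite ℂ U := Module.finite_of_finrank_pos (by rw [h]; norm_num)
  let b : Module.Basis (Fin 2) ℂ U := Module.finBasisOfFinrankEq ℂ U h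
  refine ⟨((LinearMap.toMatrixAlgEquiv b : _ ≃ₐ[ℂ] M2) : Module.End ℂ U →* M2).comp τ, fun g hg => ?_⟩
  apply (LinearMap.toMatrixAlgEquiv b).injective
  rw [map_one]
  exact hg

theorem toC {U : Type*} [AddCommGroup U] [Module ℂ U] (h : Module.finrank ℂ U = 1)
    (τ : G →* Module.End ℂ U) : ∃ χ : G →* ℂ, ∀ g, χ g = 1 → τ g = 1 := by
  have : Module.Finite ℂ U := Module.finite_of_finrank_pos (by rw [h]; norm_num)
  let b : Module.Basis (Fin 1) ℂ U := Module.finBasisOfFinrankEq ℂ U h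
  refine ⟨(LinearMap.det : Module.End ℂ U →* ℂ).comp τ, fun g hg => ?_⟩
  apply (LinearMap.toMatrixAlgEquiv b).injective
  rw [map_one]
  have hg' : LinearMap.det (τ g) = 1 := hg
  rw [← LinearMap.det_toMatrix b, Matrix.det_fin_one] at hg'
  ext i j
  fin_cases i
  fin_cases j
  exact hg'

theorem red_case {V : Type*} [AddCommGroup V] [Module ℂ V] [Finite G] {ρ : G →* Module.End ℂ V}
    (hi : Function.Injective ρ) (hd : Module.finrank ℂ V = 3) (hr : ¬ Irr ρ)
    (hn : ¬ E2 G) (he : ∀ H : Subgroup G, H ≠ ⊤ → E2 H) :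
    ∀ x ∈ commutator G, ∀ y ∈ commutator G, x * y = y * x := by
  have : Module.Finite ℂ V := Module.finite_of_finrank_pos (by rw [hd]; norm_num)
  unfold Irr at hr
  push Not at hr
  obtain ⟨U, hU, hb, ht⟩ := hr
  let τ : G →* Module.End ℂ U :=
    { toFun := fun g => (ρ g).restrict (hU g)
      map_one' := by ext v; simp
      map_mul' := fun a b => by ext v; simp }
  let π : G →* Module.End ℂ (V ⧸ U) :=
    { toFun := fun g => U.mapQ U (ρ g) (hU g)
      map_one' := by ext v; simp
      map_mul' := fun a b => by ext v; simp }
  have hk : ∀ g, τ g = 1 → π g = 1 → g = 1 := by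
    intro g h1 h2
    have a1 : ∀ v ∈ U, ρ g v = v := by
      intro v hv
      have := congrArg Subtype.val (LinearMap.congr_fun h1 ⟨v, hv⟩)
      exact this
    have a2 : ∀ v, ρ g v - v ∈ U := by
      intro v
      have : U.mkQ (ρ g v) = U.mkQ v := LinearMap.congr_fun h2 (U.mkQ v)
      exact (Submodule.Quotient.eq U).1 this
    apply hi
    rw [map_one]
    ext v
    have a3 : ∀ n : ℕ, ρ (g ^ n) v = v + (n : ℂ) • (ρ g v - v) := by
      intro n
      induction n with
      | zero => simp
      | succ n ih =>
        rw [pow_succ', rho_mul, ih, map_add, map_smul, a1 _ (a2 v)]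
        push_cast
        rw [add_smul, one_smul]
        abel
    have a4 := a3 (orderOf g)
    rw [pow_orderOf_eq_one, map_one] at a4
    have a5 : (orderOf g : ℂ) • (ρ g v - v) = 0 := by
      have : v = v + (orderOf g : ℂ) • (ρ g v - v) := a4
      exact left_eq_add.1 this
    rcases smul_eq_zero.1 a5 with h | h
    · exact absurd (Nat.cast_eq_zero.1 h) (orderOf_pos g).ne'
    · exact sub_eq_zero.1 h
  have hdim := Submodule.finrank_quotient_add_finrank U
  have h0 : 0 < Module.finrank ℂ U := by
    rw [Module.finrank_pos_iff]
    exact (Submodule.nontrivial_iff_ne_bot).2 hb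
  have h3 : Module.finrank ℂ U < Module.finrank ℂ V := Submodule.finrank_lt ht
  rw [hd] at hdim h3
  by_cases h1 : Module.finrank ℂ U = 1
  · obtain ⟨χ, hχ⟩ := toC h1 τ
    obtain ⟨σ, hσ⟩ := toM2 (by omega) π
    exact red_core σ χ (fun g a b => hk g (hχ g b) (hσ g a)) hn he
  · obtain ⟨χ, hχ⟩ := toC (by omega) π
    obtain ⟨σ, hσ⟩ := toM2 (by omega) τ
    exact red_core σ χ (fun g a b => hk g (hσ g a) (hχ g b)) hn he

theorem final_core {V : Type*} [AddCommGroup V] [Module ℂ V] [Finite G] {ρ : G →* Module.End ℂ V}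
    (hi : Function.Injective ρ) (hd : Module.finrank ℂ V = 3)
    (hn : ¬ E2 G) (he : ∀ H : Subgroup G, H ≠ ⊤ → E2 H) :
    ∀ x ∈ commutator G, ∀ y ∈ commutator G, x * y = y * x := by
  by_cases hr : Irr ρ
  · by_cases hp : commutator G = ⊤
    · exact (ctx_false (ρ := ρ) ⟨hp, hi, hd, hr, he⟩).elim
    · exact clifford hi hd hr (commutator G) (L1 hd _ (commutator G) rfl (he _ hp) _
        (hi.comp (Subgroup.subtype_injective _)))
  · exact red_case hi hd hr hn he
end

theorem rdim_mem {G : Type*} [Group G] {n : ℕ} (ρ : G →* GL (Fin n) ℂ) (h : Function.Injective ρ) :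
    ∃ σ : G →* GL (Fin (rdim G)) ℂ, Function.Injective σ :=
  Nat.sInf_mem (s := {n : ℕ | ∃ ρ : G →* GL (Fin n) ℂ, Function.Injective ρ}) ⟨n, ρ, h⟩

theorem E2_of_GL {G : Type*} [Group G] {n : ℕ} (hn : n < 3) (ρ : G →* GL (Fin n) ℂ)
    (h : Function.Injective ρ) : E2 G := by
  have hi : Function.Injective (fun g => (ρ g : Matrix (Fin n) (Fin n) ℂ)) :=
    fun a b e => h (Units.ext e)
  interval_cases n
  · refine ⟨1, fun a b _ => hi ?_⟩
    ext i
    exact i.elim0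
  · refine ⟨{ toFun := fun g => ((ρ g : Matrix (Fin 1) (Fin 1) ℂ) 0 0) • (1 : M2)
              map_one' := by simp
              map_mul' := fun a b => by
                rw [smul_mul_smul_comm, mul_one]
                simp [Matrix.mul_apply] }, fun a b e => hi ?_⟩
    have e' := smul_one_inj e
    ext i j
    fin_cases i
    fin_cases j
    exact e'
  · exact ⟨(Units.coeHom _).comp ρ, hi⟩

theorem stmt_7 (G : Type*) [Group G] [Finite G] (h : MinFaithful G 3) :
    ∀ a b : commutator G, a * b = b * a := by
  obtain ⟨h3, hH⟩ := h
  have hne : {n : ℕ | ∃ ρ : G →* GL (Fin n) ℂ, Function.Injective ρ}.Nonempty := by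
    rw [Set.nonempty_iff_ne_empty]
    intro e
    rw [rdim, e, Nat.sInf_empty] at h3
    exact absurd h3 (by norm_num)
  have hm := Nat.sInf_mem hne
  change ∃ ρ : G →* GL (Fin (rdim G)) ℂ, Function.Injective ρ at hm
  rw [h3] at hm
  obtain ⟨ρ, hρ⟩ := hm
  have hn : ¬ E2 G := by
    rintro ⟨σ, hσ⟩
    have : rdim G ≤ 2 := Nat.sInf_le ⟨σ.toHomUnits, fun a b e => hσ (congrArg Units.val e)⟩
    omega
  have he : ∀ H : Subgroup G, H ≠ ⊤ → E2 H := by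
    intro H hHt
    obtain ⟨σ, hσ⟩ := rdim_mem (ρ.comp H.subtype) (hρ.comp H.subtype_injective)
    exact E2_of_GL (hH H hHt) σ hσ
  let ρ' : G →* Module.End ℂ (Fin 3 → ℂ) :=
    ((Matrix.toLinAlgEquiv' : Matrix (Fin 3) (Fin 3) ℂ ≃ₐ[ℂ] _) :
      Matrix (Fin 3) (Fin 3) ℂ →* Module.End ℂ (Fin 3 → ℂ)).comp ((Units.coeHom _).comp ρ)
  have hi : Function.Injective ρ' := fun a b e =>
    hρ (Units.ext (Matrix.toLinAlgEquiv'.injective e))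
  have := final_core hi (by simp) hn he
  intro a b
  exact Subtype.ext (this a a.2 b b.2)
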